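/- arXiv:1206.3066 — 6 statements merged into one kernel-verified Lean document; each statement's English description precedes it below -/
import Mathlib

section
/- Under Assumption (A), for any γ ∈ Γ the function h_γ : ℤ_+^d → ℝ defined by h_γ(x) = Σ_{i=1}^d exp(γ⃗_i · x) satisfies limsup_{|x|→∞, x∈ℤ_+^d} (ℒh_γ)(x)/h_γ(x) = − min_{1≤i≤d} (γ_i/G_{ii}) (μ_i/(1+γ_i) − ν_i). -/
open scoped BigOperators
open Filter

/-- The `i`-th standard unit vector in `ℤ^d`. -/
def unitZ {d : ℕ} (i : Fin d) : Fin d → ℤ := fun k => if k = i then 1 else 0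

/-- The jump rates `q(y)` of the Jackson network: `q(ε^i) = λ_i`,
`q(-ε^i) = μ_i p_{i0}`, `q(ε^j - ε^i) = μ_i p_{ij}` and `q(y) = 0` otherwise. -/
noncomputable def qrate {d : ℕ} (lam mu : Fin d → ℝ) (P : Fin d → Fin d → ℝ)
    (y : Fin d → ℤ) : ℝ :=
  (∑ i, lam i * (if y = unitZ i then 1 else 0))
    + (∑ i, mu i * (1 - ∑ j, P i j) * (if y = -unitZ i then 1 else 0))
    + (∑ i, ∑ j, mu i * P i j * (if y = unitZ j - unitZ i then 1 else 0))

/-- Assumption (A): irreducibility of the matrix `(q(x - y); x, y ∈ ℤ^d)`. -/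
def AssumptionA {d : ℕ} (lam mu : Fin d → ℝ) (P : Fin d → Fin d → ℝ) : Prop :=
  ∀ x y : Fin d → ℤ, ∃ (n : ℕ) (c : Fin (n + 1) → Fin d → ℤ),
    c 0 = x ∧ c (Fin.last n) = y ∧
      ∀ k : Fin n, 0 < qrate lam mu P (c k.succ - c k.castSucc)

/-- The generator `ℒ` of the Jackson network:
`(ℒ f)(x) = ∑_{z ∈ ℤ_+^d} q(z - x) (f z - f x)`. -/
noncomputable def gen {d : ℕ} (lam mu : Fin d → ℝ) (P : Fin d → Fin d → ℝ)
    (f : (Fin d → ℕ) → ℝ) (x : Fin d → ℕ) : ℝ :=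
  ∑' z : Fin d → ℕ, qrate lam mu P (fun k => (z k : ℤ) - (x k : ℤ)) * (f z - f x)

/-- The hitting-probability matrix `Q j i = G j i / G i i`. -/
noncomputable def hitQ {d : ℕ} (G : Fin d → Fin d → ℝ) : Fin d → Fin d → ℝ :=
  fun j i => G j i / G i i

/-- The vector `γ⃗_i`, with components `γ_i^j = log (1 + Q j i * γ i)`. -/
noncomputable def gvec {d : ℕ} (Q : Fin d → Fin d → ℝ) (γ : Fin d → ℝ) (i j : Fin d) : ℝ :=
  Real.log (1 + Q j i * γ i)

/-- The set `Γ`: all `γ ∈ ℝ_+^d` such that for every `i` and every nonzero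
`v ∈ ℝ_+^d` with `v i = 0` one has `γ⃗_i ⬝ v < max_j γ⃗_j ⬝ v`. -/
def GammaSet (d : ℕ) (Q : Fin d → Fin d → ℝ) : Set (Fin d → ℝ) :=
  {γ | (∀ i, 0 ≤ γ i) ∧
    ∀ i : Fin d, ∀ v : Fin d → ℝ, (∀ j, 0 ≤ v j) → v ≠ 0 → v i = 0 →
      (∑ j, gvec Q γ i j * v j) < ⨆ l : Fin d, ∑ j, gvec Q γ l j * v j}

/-- A single jump `u` contributes `f (x + u) - f x` to the generator sum of an exponential `f`,
provided that `x + u` stays in the orthant. -/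
lemma hasSum_jump {d : ℕ} (w : Fin d → ℝ) (x : Fin d → ℕ) (u : Fin d → ℤ) :
    HasSum (fun z : Fin d → ℕ => (if (fun k => (z k : ℤ) - (x k : ℤ)) = u then (1 : ℝ) else 0) *
        (Real.exp (∑ j, w j * (z j : ℝ)) - Real.exp (∑ j, w j * (x j : ℝ))))
      (if ∀ k, 0 ≤ (x k : ℤ) + u k then
        Real.exp (∑ j, w j * (x j : ℝ)) * (Real.exp (∑ j, w j * (u j : ℝ)) - 1) else 0) := by
  split_ifs with h
  · have key := hasSum_single (fun k => ((x k : ℤ) + u k).toNat)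
      (f := fun z : Fin d → ℕ => (if (fun k => (z k : ℤ) - (x k : ℤ)) = u then (1 : ℝ) else 0) *
        (Real.exp (∑ j, w j * (z j : ℝ)) - Real.exp (∑ j, w j * (x j : ℝ)))) (by
        intro z hz
        rw [if_neg, zero_mul]
        rintro rfl
        exact hz (by ext k; simp))
    convert key using 1
    have hcast : ∀ k, (((x k : ℤ) + u k).toNat : ℝ) = x k + u k := fun k => by
      have := Int.toNat_of_nonneg (h k)
      exact_mod_cast congrArg (Int.cast : ℤ → ℝ) this
    rw [if_pos (by ext k; rw [Int.toNat_of_nonneg (h k)]; ring)]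
    simp only [hcast, mul_add, Finset.sum_add_distrib, Real.exp_add]
    ring
  · convert hasSum_zero using 2 with z
    rw [if_neg, zero_mul]
    rintro rfl
    exact h fun k => by simp

/-- The generator sum of an exponential function. -/
lemma hasSum_gen_exp {d : ℕ} (lam mu : Fin d → ℝ) (P : Fin d → Fin d → ℝ)
    (hPdiag : ∀ i, P i i = 0) (w : Fin d → ℝ) (x : Fin d → ℕ) :
    HasSum (fun z : Fin d → ℕ => qrate lam mu P (fun k => (z k : ℤ) - (x k : ℤ)) *
        (Real.exp (∑ j, w j * (z j : ℝ)) - Real.exp (∑ j, w j * (x j : ℝ))))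
      (Real.exp (∑ j, w j * (x j : ℝ)) * (∑ j, lam j * (Real.exp (w j) - 1) +
        ∑ j, if x j = 0 then 0 else mu j * ((1 - ∑ k, P j k) * (Real.exp (-w j) - 1) +
          ∑ k, P j k * (Real.exp (w k - w j) - 1)))) := by
  have h1 := hasSum_sum (s := Finset.univ)
    fun (i : Fin d) _ => (hasSum_jump w x (unitZ i)).mul_left (lam i)
  have h2 := hasSum_sum (s := Finset.univ)
    fun (i : Fin d) _ => (hasSum_jump w x (-unitZ i)).mul_left (mu i * (1 - ∑ j, P i j))
  have h3 := hasSum_sum (s := Finset.univ) fun (i : Fin d) _ => hasSum_sum (s := Finset.univ)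
    fun (j : Fin d) _ => (hasSum_jump w x (unitZ j - unitZ i)).mul_left (mu i * P i j)
  convert (h1.add h2).add h3 using 1
  · rfl
  · ext z
    simp only [qrate, add_mul, Finset.sum_mul, mul_assoc]
  · rw [mul_add, Finset.mul_sum, add_assoc]
    congr 1
    · refine Finset.sum_congr rfl fun j _ => ?_
      rw [if_pos (fun k => by unfold unitZ; split_ifs <;> omega)]
      simp [unitZ]
      ring
    · rw [← Finset.sum_add_distrib, Finset.mul_sum]
      refine Finset.sum_congr rfl fun i _ => ?_
      split_ifs with hx h h
      · exact absurd (h i) (by simp [unitZ, hx])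
      · rw [mul_zero, mul_zero, zero_add]
        refine (Finset.sum_eq_zero fun j _ => ?_).symm
        rcases eq_or_ne i j with rfl | hij
        · simp [hPdiag]
        · rw [if_neg, mul_zero]
          exact fun h => absurd (h i) (by simp [unitZ, hx, hij])
      · rw [mul_add, mul_add, Finset.mul_sum, Finset.mul_sum]
        congr 1
        · simp [unitZ]
          ring
        · refine Finset.sum_congr rfl fun j _ => ?_
          rw [if_pos (fun k => by
            have := h k
            simp only [unitZ, Pi.neg_apply, Pi.sub_apply] at this ⊢
            split_ifs at this ⊢ <;> omega)]
          simp [unitZ, mul_sub, Finset.sum_sub_distrib]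
          ring
      · refine absurd (fun k => ?_) h
        simp only [unitZ, Pi.neg_apply]
        split_ifs with hk
        · subst hk; omega
        · omega

lemma hitQ_self {d : ℕ} {G : Fin d → Fin d → ℝ} (hGdiag : ∀ i, 1 ≤ G i i) (i : Fin d) :
    hitQ G i i = 1 :=
  div_self (by linarith [hGdiag i])

/-- First-step analysis for the hitting probabilities. -/
lemma sum_mul_hitQ {d : ℕ} {P G : Fin d → Fin d → ℝ}
    (hG2 : ∀ i k, ∑ j, ((if i = j then (1 : ℝ) else 0) - P i j) * G j k
      = if i = k then 1 else 0) (i j : Fin d) :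
    ∑ k, P j k * hitQ G k i = hitQ G j i - if j = i then 1 / G i i else 0 := by
  have h := hG2 j i
  simp only [sub_mul, ite_mul, one_mul, zero_mul, Finset.sum_sub_distrib, Finset.sum_ite_eq,
    Finset.mem_univ, if_true] at h
  simp only [hitQ, mul_div_assoc', ← Finset.sum_div]
  rw [show ∑ k, P j k * G k i = G j i - if j = i then 1 else 0 by linarith]
  split_ifs <;> ring

/-- The solution of the traffic equations is `ν = λ G`. -/
lemma sum_mul_green {d : ℕ} {lam ν : Fin d → ℝ} {P G : Fin d → Fin d → ℝ}
    (hG2 : ∀ i k, ∑ j, ((if i = j then (1 : ℝ) else 0) - P i j) * G j k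
      = if i = k then 1 else 0)
    (hν : ∀ j, ν j = lam j + ∑ i, ν i * P i j) (i : Fin d) :
    ∑ j, lam j * G j i = ν i := by
  have hl : ∀ j, lam j = ∑ k, ν k * ((if k = j then (1 : ℝ) else 0) - P k j) := fun j => by
    simp only [mul_sub, mul_ite, mul_one, mul_zero, Finset.sum_sub_distrib, Finset.sum_ite_eq',
      Finset.mem_univ, if_true]
    linarith [hν j]
  simp only [hl, Finset.sum_mul]
  rw [Finset.sum_comm]
  simp only [mul_assoc, ← Finset.mul_sum, hG2]
  simp

/-- Each exponential is an eigenfunction of the generator away from the face `x i = 0`. -/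
lemma exp_gvec_rate {d : ℕ} (lam mu : Fin d → ℝ) (P G : Fin d → Fin d → ℝ)
    (hG2 : ∀ i k, ∑ j, ((if i = j then (1 : ℝ) else 0) - P i j) * G j k
      = if i = k then 1 else 0)
    (hGnn : ∀ i j, 0 ≤ G i j) (hGdiag : ∀ i, 1 ≤ G i i)
    (ν : Fin d → ℝ) (hν : ∀ j, ν j = lam j + ∑ i, ν i * P i j)
    (γ : Fin d → ℝ) (hγ : ∀ i, 0 ≤ γ i) (x : Fin d → ℕ) (i : Fin d) :
    (∑ j, lam j * (Real.exp (gvec (hitQ G) γ i j) - 1) +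
        ∑ j, if x j = 0 then 0 else
          mu j * ((1 - ∑ k, P j k) * (Real.exp (-gvec (hitQ G) γ i j) - 1) +
          ∑ k, P j k * (Real.exp (gvec (hitQ G) γ i k - gvec (hitQ G) γ i j) - 1))) =
      -(γ i / G i i * (mu i / (1 + γ i) - ν i)) +
        if x i = 0 then γ i / G i i * (mu i / (1 + γ i)) else 0 := by
  have hpos : ∀ j, 0 < 1 + hitQ G j i * γ i := fun j => by
    have : 0 ≤ hitQ G j i := div_nonneg (hGnn j i) (by linarith [hGdiag i])
    nlinarith [mul_nonneg this (hγ i)]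
  have hexp : ∀ j, Real.exp (gvec (hitQ G) γ i j) = 1 + hitQ G j i * γ i := fun j =>
    Real.exp_log (hpos j)
  have h1 : ∑ j, lam j * (Real.exp (gvec (hitQ G) γ i j) - 1) = γ i / G i i * ν i := by
    rw [← sum_mul_green hG2 hν i, Finset.mul_sum]
    refine Finset.sum_congr rfl fun j _ => ?_
    rw [hexp, hitQ]
    ring
  have h2 : ∀ j, (1 - ∑ k, P j k) * (Real.exp (-gvec (hitQ G) γ i j) - 1) +
      ∑ k, P j k * (Real.exp (gvec (hitQ G) γ i k - gvec (hitQ G) γ i j) - 1) =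
      if j = i then -(γ i / G i i / (1 + γ i)) else 0 := fun j => by
    have hj := hpos j
    have hs : ∑ k, P j k * (Real.exp (gvec (hitQ G) γ i k - gvec (hitQ G) γ i j) - 1) =
        (∑ k, P j k + γ i * ∑ k, P j k * hitQ G k i) / (1 + hitQ G j i * γ i) - ∑ k, P j k := by
      rw [Finset.mul_sum, ← Finset.sum_add_distrib, Finset.sum_div, ← Finset.sum_sub_distrib]
      refine Finset.sum_congr rfl fun k _ => ?_
      rw [Real.exp_sub, hexp, hexp]
      ring
    rw [hs, sum_mul_hitQ hG2, Real.exp_neg, hexp]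
    split_ifs with h
    · subst h
      have := hγ j
      have hG : G j j ≠ 0 := by linarith [hGdiag j]
      rw [hitQ_self hGdiag]
      have : 1 + γ j ≠ 0 := by linarith
      field_simp
      ring
    · field_simp
      ring
  rw [h1]
  simp only [h2]
  rw [Finset.sum_eq_single i (fun j _ hj => by simp [hj]) (by simp), if_pos rfl]
  split_ifs <;> ring

lemma tendsto_sum_cofinite_atTop (d : ℕ) :
    Tendsto (fun x : Fin d → ℕ => ((∑ j, x j : ℕ) : ℝ)) cofinite atTop := by
  refine tendsto_natCast_atTop_atTop.comp (tendsto_atTop.2 fun b => ?_)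
  rw [eventually_cofinite]
  refine (Set.finite_Iic (fun _ : Fin d => b)).subset fun x hx j => ?_
  have := Finset.single_le_sum (f := x) (fun _ _ => Nat.zero_le _) (Finset.mem_univ j)
  exact this.trans (not_le.1 hx).le

/-- On the face `x i = 0`, the `i`-th exponential is negligible with respect to the sum, as soon as
its exponent is strictly dominated on that face. -/
lemma tendsto_weight_face {d : ℕ} (g : Fin d → Fin d → ℝ) (i : Fin d)
    (hg : ∀ v : Fin d → ℝ, (∀ j, 0 ≤ v j) → v ≠ 0 → v i = 0 →
      (∑ j, g i j * v j) < ⨆ l : Fin d, ∑ j, g l j * v j) :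
    Tendsto (fun x : Fin d → ℕ => if x i = 0 then
      Real.exp (∑ j, g i j * (x j : ℝ)) / ∑ l, Real.exp (∑ j, g l j * (x j : ℝ)) else 0)
      cofinite (nhds 0) := by
  have : Nonempty (Fin d) := ⟨i⟩
  set φ : (Fin d → ℝ) → ℝ := fun v => ∑ l, max (∑ j, g l j * v j - ∑ j, g i j * v j) 0 with hφ
  have hφc : Continuous φ := by fun_prop
  have hK : IsCompact (stdSimplex ℝ (Fin d) ∩ {v | v i = 0}) :=
    (isCompact_stdSimplex ℝ (Fin d)).inter_right
      (isClosed_eq (continuous_apply i) continuous_const)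
  obtain ⟨δ, hδ, hφδ⟩ := hK.exists_forall_le' hφc.continuousOn (a := 0) (by
    rintro v ⟨hv, hvi⟩
    have hv0 : v ≠ 0 := by
      rintro rfl
      simpa using hv.2
    obtain ⟨l, hl⟩ := exists_lt_of_lt_ciSup (hg v hv.1 hv0 hvi)
    exact Finset.sum_pos' (fun _ _ => le_max_right _ _)
      ⟨l, Finset.mem_univ l, lt_max_of_lt_left (by linarith)⟩)
  have hlim : Tendsto (fun x : Fin d → ℕ => (δ * ((∑ j, x j : ℕ) : ℝ))⁻¹) cofinite (nhds 0) :=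
    ((tendsto_sum_cofinite_atTop d).const_mul_atTop hδ).inv_tendsto_atTop
  refine squeeze_zero' (Eventually.of_forall fun x => by split_ifs <;> positivity) ?_ hlim
  filter_upwards [(tendsto_sum_cofinite_atTop d).eventually_gt_atTop 0] with x hx
  split_ifs with hxi
  swap
  · positivity
  set s : ℝ := ((∑ j, x j : ℕ) : ℝ) with hs
  have hscale : φ (fun j => (x j : ℝ)) = s * φ (fun j => (x j : ℝ) / s) := by
    simp only [hφ, Finset.mul_sum]
    refine Finset.sum_congr rfl fun l _ => ?_
    rw [mul_max_of_nonneg _ _ hx.le, mul_zero, mul_sub, Finset.mul_sum, Finset.mul_sum]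
    congr 2 <;> exact Finset.sum_congr rfl fun j _ => by field_simp
  have hle : δ * s ≤ φ (fun j => (x j : ℝ)) := by
    rw [hscale, mul_comm]
    refine mul_le_mul_of_nonneg_left (hφδ _ ⟨⟨fun j => by positivity, ?_⟩, ?_⟩) hx.le
    · rw [← Finset.sum_div, ← Nat.cast_sum]
      exact div_self hx.ne'
    · simp [hxi]
  have hφexp : φ (fun j => (x j : ℝ)) ≤
      (∑ l, Real.exp (∑ j, g l j * (x j : ℝ))) / Real.exp (∑ j, g i j * (x j : ℝ)) := by
    rw [Finset.sum_div]
    refine Finset.sum_le_sum fun l _ => ?_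
    rw [← Real.exp_sub]
    have := Real.add_one_le_exp (∑ j, g l j * (x j : ℝ) - ∑ j, g i j * (x j : ℝ))
    exact max_le (by linarith) (Real.exp_pos _).le
  rw [← inv_div]
  exact inv_anti₀ (by positivity) (hle.trans hφexp)

/-- The limsup of a weighted average of `a i`, up to vanishing errors on the faces `x i = 0`, is the
largest `a i` when the weight of each `i` vanishes at infinity on the face `x i = 0`. -/
lemma limsup_weighted {d : ℕ} (hd : 0 < d) (a b : Fin d → ℝ) (W : Fin d → (Fin d → ℕ) → ℝ)
    (hW0 : ∀ i x, 0 ≤ W i x) (hW1 : ∀ x, ∑ i, W i x = 1)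
    (hW : ∀ i, Tendsto (fun x => if x i = 0 then W i x else 0) cofinite (nhds 0)) :
    limsup (fun x => ∑ i, W i x * (-a i + if x i = 0 then b i else 0)) cofinite = -⨅ i, a i := by
  have : Nonempty (Fin d) := ⟨⟨0, hd⟩⟩
  set m := ⨅ i, a i with hm
  have hma : ∀ i, m ≤ a i := fun i => ciInf_le (Set.finite_range a).bddBelow i
  obtain ⟨i₀, hi₀⟩ : ∃ i, a i = m := exists_eq_ciInf_of_finite
  set r : (Fin d → ℕ) → ℝ := fun x => ∑ i, W i x * (-a i + if x i = 0 then b i else 0) with hr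
  set e : (Fin d → ℕ) → ℝ := fun x => ∑ i, b i * (if x i = 0 then W i x else 0) with he
  have hre : ∀ x, r x = ∑ i, W i x * (-a i) + e x := fun x => by
    simp only [hr, he, ← Finset.sum_add_distrib]
    exact Finset.sum_congr rfl fun i _ => by split_ifs <;> ring
  have he0 : Tendsto e cofinite (nhds 0) := by
    have h := tendsto_finsetSum Finset.univ fun i _ => (hW i).const_mul (b i)
    simpa only [mul_zero, Finset.sum_const_zero] using h
  have hupper : ∀ x, r x ≤ -m + e x := fun x => by
    rw [hre]
    gcongr
    calc ∑ i, W i x * (-a i) ≤ ∑ i, W i x * (-m) :=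
          Finset.sum_le_sum fun i _ => mul_le_mul_of_nonneg_left (neg_le_neg (hma i)) (hW0 i x)
      _ = -m := by rw [← Finset.sum_mul, hW1, one_mul]
  have hev : ∀ ε > 0, ∀ᶠ x in cofinite, r x ≤ -m + ε := fun ε hε => by
    filter_upwards [he0.eventually (gt_mem_nhds hε)] with x hx
    linarith [hupper x]
  set s : ℕ → Fin d → ℕ := fun n => Pi.single i₀ n with hs
  have hsc : Tendsto s atTop cofinite := by
    rw [← Nat.cofinite_eq_atTop]
    exact (Pi.single_injective i₀).tendsto_cofinite
  have hWs : ∀ l, l ≠ i₀ → Tendsto (fun n => W l (s n)) atTop (nhds 0) := fun l hl => by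
    simpa [hs, Function.comp_def, Pi.single_eq_of_ne hl] using (hW l).comp hsc
  have hWs' : Tendsto (fun n => ∑ i, W i (s n) * (m - a i)) atTop (nhds 0) := by
    rw [← Finset.sum_const_zero (s := (Finset.univ : Finset (Fin d)))]
    refine tendsto_finsetSum _ fun i _ => ?_
    by_cases h : i = i₀
    · simp [h, hi₀]
    · simpa using (hWs i h).mul_const (m - a i)
  have hrs : Tendsto (fun n => r (s n)) atTop (nhds (-m)) := by
    have h := (hWs'.add (he0.comp hsc)).const_add (-m)
    rw [add_zero, add_zero] at h
    refine h.congr fun n => ?_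
    rw [hre]
    simp only [mul_sub, Finset.sum_sub_distrib, ← Finset.sum_mul, hW1, mul_neg,
      Finset.sum_neg_distrib, Function.comp]
    ring
  have hlower : ∀ c, (∀ᶠ x in cofinite, r x ≤ c) → -m ≤ c := fun c hc =>
    le_of_tendsto hrs (hsc.eventually hc)
  refine le_antisymm (le_of_forall_pos_le_add fun ε hε => ?_) ?_
  · exact limsup_le_of_le ⟨-m, fun c hc => hlower c hc⟩ (hev ε hε)
  · exact le_limsup_of_le ⟨-m + 1, hev 1 one_pos⟩ hlower

/-- Theorem 2.1: for any γ ∈ Γ, the function h_γ(x) = Σ_i exp(γ⃗_i ⋅ x) satisfies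
limsup (ℒ h_γ)(x) / h_γ(x) = - min_i (γ_i / G_ii) (μ_i/(1+γ_i) - ν_i). -/
theorem stmt0
    (d : ℕ) (hd : 0 < d)
    (lam mu : Fin d → ℝ) (P : Fin d → Fin d → ℝ)
    (hlam : ∀ i, 0 ≤ lam i) (hmu : ∀ i, 0 < mu i)
    (hP : ∀ i j, 0 ≤ P i j) (hPdiag : ∀ i, P i i = 0) (hP0 : ∀ i, ∑ j, P i j ≤ 1)
    (hA : AssumptionA lam mu P)
    (G : Fin d → Fin d → ℝ)
    (hG1 : ∀ i k, ∑ j, G i j * ((if j = k then (1 : ℝ) else 0) - P j k)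
      = if i = k then 1 else 0)
    (hG2 : ∀ i k, ∑ j, ((if i = j then (1 : ℝ) else 0) - P i j) * G j k
      = if i = k then 1 else 0)
    (hGnn : ∀ i j, 0 ≤ G i j) (hGdiag : ∀ i, 1 ≤ G i i)
    (ν : Fin d → ℝ) (hν : ∀ j, ν j = lam j + ∑ i, ν i * P i j) (hνpos : ∀ i, 0 < ν i)
    (γ : Fin d → ℝ) (hγ : γ ∈ GammaSet d (hitQ G)) :
    Filter.limsup
      (fun x : Fin d → ℕ =>
        gen lam mu P
            (fun y => ∑ i, Real.exp (∑ j, gvec (hitQ G) γ i j * (y j : ℝ))) x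
          / ∑ i, Real.exp (∑ j, gvec (hitQ G) γ i j * (x j : ℝ)))
      Filter.cofinite
    = - ⨅ i : Fin d, γ i / G i i * (mu i / (1 + γ i) - ν i) := by
  have : Nonempty (Fin d) := ⟨⟨0, hd⟩⟩
  set g := gvec (hitQ G) γ with hg
  have hpos : ∀ x : Fin d → ℕ, 0 < ∑ i, Real.exp (∑ j, g i j * (x j : ℝ)) := fun x =>
    Finset.sum_pos (fun _ _ => Real.exp_pos _) Finset.univ_nonempty
  have hgen : ∀ x : Fin d → ℕ,
      gen lam mu P (fun y => ∑ i, Real.exp (∑ j, g i j * (y j : ℝ))) x =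
        ∑ i, Real.exp (∑ j, g i j * (x j : ℝ)) *
          (-(γ i / G i i * (mu i / (1 + γ i) - ν i)) +
            if x i = 0 then γ i / G i i * (mu i / (1 + γ i)) else 0) := fun x => by
    have h := hasSum_sum (s := Finset.univ)
      fun (i : Fin d) _ => hasSum_gen_exp lam mu P hPdiag (g i) x
    simp only [← Finset.mul_sum, Finset.sum_sub_distrib] at h
    rw [gen, h.tsum_eq]
    refine Finset.sum_congr rfl fun i _ => ?_
    rw [hg, exp_gvec_rate lam mu P G hG2 hGnn hGdiag ν hν γ hγ.1 x i]
  rw [← limsup_weighted hd (fun i => γ i / G i i * (mu i / (1 + γ i) - ν i))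
    (fun i => γ i / G i i * (mu i / (1 + γ i)))
    (fun i x => Real.exp (∑ j, g i j * (x j : ℝ)) / ∑ l, Real.exp (∑ j, g l j * (x j : ℝ)))
    (fun i x => div_nonneg (Real.exp_pos _).le (hpos x).le)
    (fun x => by rw [← Finset.sum_div, div_self (hpos x).ne'])
    (fun i => tendsto_weight_face g i (hγ.2 i))]
  congr 1
  ext x
  rw [hgen, Finset.sum_div]
  exact Finset.sum_congr rfl fun i _ => by ring
end

section
/- Under Assumption (A), let γ = (γ_1,…,γ_d) ∈ ℝ_+^d with γ_i > 0 for all i. If for every i = 1,…,d there exists a probability vector θ_i = (θ_i^1,…,θ_i^d) (θ_i^j ≥ 0, Σ_{j=1}^d θ_i^j = 1) such that γ_i^k < Σ_{j=1}^d θ_i^j γ_j^k for every k ∈ {1,…,d}\{i} with Q_{ki} > 0, then γ ∈ Γ. -/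
open scoped BigOperators
open Filter

/-- If the matrix `A` is nonnegative with positive diagonal, and its `i`-th row is dominated by a
convex combination of its rows, strictly at each column `k ≠ i` with `A i k ≠ 0`, then
`A i ⬝ v < max_l A l ⬝ v` for every nonzero `v ≥ 0` with `v i = 0`. -/
theorem sum_mul_lt_iSup_of_row_lt_convexComb {ι : Type*} [Fintype ι] {A : ι → ι → ℝ}
    (hA : ∀ l k, 0 ≤ A l k) (hAdiag : ∀ k, 0 < A k k) {i : ι} {θ : ι → ℝ}
    (hθ : ∀ j, 0 ≤ θ j) (hθsum : ∑ j, θ j = 1)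
    (hlt : ∀ k, k ≠ i → A i k ≠ 0 → A i k < ∑ j, θ j * A j k)
    {v : ι → ℝ} (hv : ∀ j, 0 ≤ v j) (hv0 : v ≠ 0) (hvi : v i = 0) :
    ∑ j, A i j * v j < ⨆ l, ∑ j, A l j * v j := by
  have hle (l : ι) : ∑ j, A l j * v j ≤ ⨆ l, ∑ j, A l j * v j :=
    le_ciSup (f := fun l => ∑ j, A l j * v j) (Set.finite_range _).bddAbove l
  by_cases h : ∃ k, v k ≠ 0 ∧ A i k ≠ 0
  · obtain ⟨k, hvk, hAk⟩ := h
    have hki : k ≠ i := by rintro rfl; exact hvk hvi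
    calc ∑ j, A i j * v j < ∑ k, (∑ j, θ j * A j k) * v k := by
          refine Finset.sum_lt_sum (fun m _ => ?_) ⟨k, Finset.mem_univ k, ?_⟩
          · by_cases hm : m = i
            · simp [hm, hvi]
            · refine mul_le_mul_of_nonneg_right ?_ (hv m)
              by_cases hAm : A i m = 0
              · rw [hAm]
                exact Finset.sum_nonneg fun j _ => mul_nonneg (hθ j) (hA j m)
              · exact (hlt m hm hAm).le
          · exact mul_lt_mul_of_pos_right (hlt k hki hAk) ((hv k).lt_of_ne' hvk)
      _ = ∑ l, θ l * ∑ j, A l j * v j := by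
          simp only [Finset.sum_mul, Finset.mul_sum, mul_assoc]
          exact Finset.sum_comm
      _ ≤ ∑ l, θ l * ⨆ l, ∑ j, A l j * v j :=
          Finset.sum_le_sum fun l _ => mul_le_mul_of_nonneg_left (hle l) (hθ l)
      _ = ⨆ l, ∑ j, A l j * v j := by rw [← Finset.sum_mul, hθsum, one_mul]
  · push Not at h
    obtain ⟨k, hk⟩ := Function.ne_iff.mp hv0
    calc ∑ j, A i j * v j = 0 := Finset.sum_eq_zero fun j _ => by
          by_cases hj : v j = 0
          · simp [hj]
          · simp [h j hj]
      _ < A k k * v k := mul_pos (hAdiag k) ((hv k).lt_of_ne' hk)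
      _ ≤ ∑ j, A k j * v j :=
          Finset.single_le_sum (f := fun j => A k j * v j)
            (fun j _ => mul_nonneg (hA k j) (hv j)) (Finset.mem_univ k)
      _ ≤ _ := hle k

/-- Proposition 2.1, part 2: if γ_i > 0 for all i and for every i there is a probability
vector θ_i with γ_i^k < Σ_j θ_i^j γ_j^k for all k ≠ i with Q_{ki} > 0, then γ ∈ Γ. -/
theorem stmt2
    (d : ℕ) (hd : 0 < d)
    (lam mu : Fin d → ℝ) (P : Fin d → Fin d → ℝ)
    (hlam : ∀ i, 0 ≤ lam i) (hmu : ∀ i, 0 < mu i)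
    (hP : ∀ i j, 0 ≤ P i j) (hPdiag : ∀ i, P i i = 0) (hP0 : ∀ i, ∑ j, P i j ≤ 1)
    (hA : AssumptionA lam mu P)
    (G : Fin d → Fin d → ℝ)
    (hG1 : ∀ i k, ∑ j, G i j * ((if j = k then (1 : ℝ) else 0) - P j k)
      = if i = k then 1 else 0)
    (hG2 : ∀ i k, ∑ j, ((if i = j then (1 : ℝ) else 0) - P i j) * G j k
      = if i = k then 1 else 0)
    (hGnn : ∀ i j, 0 ≤ G i j) (hGdiag : ∀ i, 1 ≤ G i i)
    (ν : Fin d → ℝ) (hν : ∀ j, ν j = lam j + ∑ i, ν i * P i j) (hνpos : ∀ i, 0 < ν i)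
    (γ : Fin d → ℝ) (hγpos : ∀ i, 0 < γ i)
    (hθ : ∀ i : Fin d, ∃ θ : Fin d → ℝ, (∀ j, 0 ≤ θ j) ∧ (∑ j, θ j) = 1 ∧
      ∀ k : Fin d, k ≠ i → 0 < hitQ G k i →
        gvec (hitQ G) γ i k < ∑ j, θ j * gvec (hitQ G) γ j k) :
    γ ∈ GammaSet d (hitQ G) := by
  have hQ (j i : Fin d) : 0 ≤ hitQ G j i := div_nonneg (hGnn j i) (hGnn i i)
  refine ⟨fun i => (hγpos i).le, fun i v hv hv0 hvi => ?_⟩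
  obtain ⟨θ, hθnn, hθsum, hlt⟩ := hθ i
  refine sum_mul_lt_iSup_of_row_lt_convexComb (fun l k => ?_) (fun k => ?_) hθnn hθsum
    (fun k hki hk => hlt k hki ((hQ k i).lt_of_ne' fun h => hk ?_)) hv hv0 hvi
  · exact Real.log_nonneg (le_add_of_nonneg_right (mul_nonneg (hQ k l) (hγpos l).le))
  · have hQk : hitQ G k k = 1 := div_self (zero_lt_one.trans_le (hGdiag k)).ne'
    exact Real.log_pos (by rw [hQk, one_mul]; exact lt_add_of_pos_right 1 (hγpos k))
  · simp [gvec, h]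
end

section
/- Under Assumptions (A) and (B), let ρ = (ρ_1,…,ρ_d) ∈ ℝ^d satisfy (ρP)_i < ρ_i for all i = 1,…,d. Then for every ε with 0 < ε < min_{1≤i≤d} (ρ_i/G_{ii})·x_ρ, the vector γ = (γ_1,…,γ_d) defined by γ_i = ε G_{ii}/ρ_i belongs to Γ. -/
open scoped BigOperators
open Filter

/-- The quantity 𝓡(ρ) = max_i (ρP)_i / ρ_i. -/
noncomputable def Rrho {d : ℕ} (P : Fin d → Fin d → ℝ) (ρ : Fin d → ℝ) : ℝ :=
  ⨆ i : Fin d, (∑ j, ρ j * P j i) / ρ i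

/-- The quantity x_ρ = sup {x > 0 : log(1+x) ≥ 𝓡(ρ)·x} ∈ (0, ∞], as an extended real. -/
noncomputable def xrho (R : ℝ) : EReal :=
  sSup {y : EReal | ∃ x : ℝ, y = (x : EReal) ∧ 0 < x ∧ R * x ≤ Real.log (1 + x)}

/-- The weights of a vector `ρ` with `ρ (1 - P) > 0` are positive. -/
theorem pos_of_strictly_excessive {d : ℕ} {P G : Fin d → Fin d → ℝ}
    (hG2 : ∀ i k, ∑ j, ((if i = j then (1 : ℝ) else 0) - P i j) * G j k
      = if i = k then 1 else 0)
    (hGnn : ∀ i j, 0 ≤ G i j) (hGdiag : ∀ i, 1 ≤ G i i)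
    {ρ : Fin d → ℝ} (hρ : ∀ i, ∑ j, ρ j * P j i < ρ i) (i : Fin d) : 0 < ρ i := by
  have key : ρ i = ∑ j, (ρ j - ∑ l, ρ l * P l j) * G j i := by
    have h1 : ρ i = ∑ l, ρ l * ∑ j, ((if l = j then (1 : ℝ) else 0) - P l j) * G j i := by
      simp [hG2]
    have h2 : ∀ j, ρ j - ∑ l, ρ l * P l j
        = ∑ l, ρ l * ((if l = j then (1 : ℝ) else 0) - P l j) := by
      intro j
      simp [mul_sub, Finset.sum_sub_distrib]
    rw [h1]
    simp only [h2, Finset.mul_sum, Finset.sum_mul]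
    rw [Finset.sum_comm]
    simp only [mul_assoc]
  rw [key]
  refine Finset.sum_pos' (fun j _ => mul_nonneg (sub_nonneg.2 (hρ j).le) (hGnn j i))
    ⟨i, Finset.mem_univ i, mul_pos (sub_pos.2 (hρ i)) (by linarith [hGdiag i])⟩

/-- A vector with `h ≤ P h` is nonpositive when `1 - P` has a nonnegative inverse. -/
theorem nonpos_of_le_mul {d : ℕ} {P G : Fin d → Fin d → ℝ}
    (hG1 : ∀ i k, ∑ j, G i j * ((if j = k then (1 : ℝ) else 0) - P j k)
      = if i = k then 1 else 0)
    (hGnn : ∀ i j, 0 ≤ G i j) {h : Fin d → ℝ} (hh : ∀ j, h j ≤ ∑ l, P j l * h l)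
    (i : Fin d) : h i ≤ 0 := by
  have key : h i = ∑ j, G i j * (h j - ∑ l, P j l * h l) := by
    have h1 : h i = ∑ k, (∑ j, G i j * ((if j = k then (1 : ℝ) else 0) - P j k)) * h k := by
      simp [hG1]
    have h2 : ∀ j, h j - ∑ l, P j l * h l
        = ∑ l, ((if j = l then (1 : ℝ) else 0) - P j l) * h l := by
      intro j
      simp [sub_mul, Finset.sum_sub_distrib]
    rw [h1]
    simp only [h2, Finset.mul_sum, Finset.sum_mul]
    rw [Finset.sum_comm]
    simp only [mul_assoc]
  rw [key]
  exact Finset.sum_nonpos fun j _ =>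
    mul_nonpos_of_nonneg_of_nonpos (hGnn i j) (sub_nonpos.2 (hh j))

/-- Maximum principle: each column of the Green matrix is maximal on the diagonal. -/
theorem green_le_diag {d : ℕ} {P G : Fin d → Fin d → ℝ}
    (hP : ∀ i j, 0 ≤ P i j) (hP0 : ∀ i, ∑ j, P i j ≤ 1)
    (hG1 : ∀ i k, ∑ j, G i j * ((if j = k then (1 : ℝ) else 0) - P j k)
      = if i = k then 1 else 0)
    (hG2 : ∀ i k, ∑ j, ((if i = j then (1 : ℝ) else 0) - P i j) * G j k
      = if i = k then 1 else 0)
    (hGnn : ∀ i j, 0 ≤ G i j) (i k : Fin d) : G i k ≤ G k k := by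
  have hmax := nonpos_of_le_mul hG1 hGnn (h := fun j => max (G j k - G k k) 0) (fun j => by
    have hnn : 0 ≤ ∑ l, P j l * max (G l k - G k k) 0 :=
      Finset.sum_nonneg fun l _ => mul_nonneg (hP j l) (le_max_right _ _)
    refine max_le ?_ hnn
    by_cases hjk : j = k
    · simpa [hjk] using (hjk ▸ hnn)
    · have h1 := hG2 j k
      simp only [sub_mul, Finset.sum_sub_distrib, if_neg hjk, ite_mul, one_mul, zero_mul,
        Finset.sum_ite_eq, Finset.mem_univ, if_true] at h1
      have h2 : ∑ l, P j l * (G l k - G k k) ≤ ∑ l, P j l * max (G l k - G k k) 0 :=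
        Finset.sum_le_sum fun l _ => mul_le_mul_of_nonneg_left (le_max_left _ _) (hP j l)
      simp only [mul_sub, Finset.sum_sub_distrib, ← Finset.sum_mul] at h2
      have h3 := mul_le_mul_of_nonneg_right (hP0 j) (hGnn k k)
      linarith) i
  have := (le_max_left (G i k - G k k) 0).trans hmax
  linarith

/-- The inequality `R y ≤ log (1 + y)` holds on `[0, x_ρ)`. -/
theorem mul_le_log_of_lt_xrho {R y : ℝ} (hy : 0 ≤ y) (h : (y : EReal) < xrho R) :
    R * y ≤ Real.log (1 + y) := by
  obtain ⟨_, ⟨x, rfl, hx, hRx⟩, hyx⟩ := lt_sSup_iff.1 h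
  have hyx : y < x := EReal.coe_lt_coe_iff.1 hyx
  have hc := strictConcaveOn_log_Ioi.concaveOn.2
    (Set.mem_Ioi.2 one_pos) (Set.mem_Ioi.2 (by linarith : 0 < 1 + x))
    (sub_nonneg.2 ((div_le_one hx).2 hyx.le)) (by positivity : 0 ≤ y / x) (by ring)
  have he : (1 - y / x) * 1 + y / x * (1 + x) = 1 + y := by field_simp; ring
  simp only [smul_eq_mul, Real.log_one, mul_zero, zero_add, he] at hc
  refine le_trans ?_ hc
  have hmul := mul_le_mul_of_nonneg_left hRx (by positivity : 0 ≤ y / x)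
  have he' : y / x * (R * x) = R * y := by field_simp
  linarith

/-- Theorem 2.2: if ρ satisfies (ρP)_i < ρ_i for all i, then for every ε with
0 < ε < min_i (ρ_i / G_ii) · x_ρ, the vector γ_i = ε G_ii / ρ_i belongs to Γ. -/
theorem stmt3
    (d : ℕ) (hd : 0 < d)
    (lam mu : Fin d → ℝ) (P : Fin d → Fin d → ℝ)
    (hlam : ∀ i, 0 ≤ lam i) (hmu : ∀ i, 0 < mu i)
    (hP : ∀ i j, 0 ≤ P i j) (hPdiag : ∀ i, P i i = 0) (hP0 : ∀ i, ∑ j, P i j ≤ 1)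
    (hA : AssumptionA lam mu P)
    (G : Fin d → Fin d → ℝ)
    (hG1 : ∀ i k, ∑ j, G i j * ((if j = k then (1 : ℝ) else 0) - P j k)
      = if i = k then 1 else 0)
    (hG2 : ∀ i k, ∑ j, ((if i = j then (1 : ℝ) else 0) - P i j) * G j k
      = if i = k then 1 else 0)
    (hGnn : ∀ i j, 0 ≤ G i j) (hGdiag : ∀ i, 1 ≤ G i i)
    (ν : Fin d → ℝ) (hν : ∀ j, ν j = lam j + ∑ i, ν i * P i j) (hνpos : ∀ i, 0 < ν i)
    (hB : ∀ i, ν i < mu i)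
    (ρ : Fin d → ℝ) (hρ : ∀ i, ∑ j, ρ j * P j i < ρ i)
    (ε : ℝ) (hε : 0 < ε)
    (hεlt : ∀ i : Fin d, (ε : EReal) < ((ρ i / G i i : ℝ) : EReal) * xrho (Rrho P ρ)) :
    (fun i => ε * G i i / ρ i) ∈ GammaSet d (hitQ G) := by
  have hρpos := pos_of_strictly_excessive hG2 hGnn hGdiag hρ
  have hGpos : ∀ i, 0 < G i i := fun i => by linarith [hGdiag i]
  set x : Fin d → Fin d → ℝ := fun j k => ε * G j k / ρ k with hx
  have hx0 : ∀ j k, 0 ≤ x j k := fun j k =>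
    div_nonneg (mul_nonneg hε.le (hGnn j k)) (hρpos k).le
  have hgv : ∀ i j, gvec (hitQ G) (fun i => ε * G i i / ρ i) i j = Real.log (1 + x j i) := by
    intro i j
    have := (hGpos i).ne'
    have := (hρpos i).ne'
    simp only [gvec, hitQ, hx]
    congr 2
    field_simp
  have hdiag : ∀ k, ((x k k : ℝ) : EReal) < xrho (Rrho P ρ) := by
    intro k
    by_contra! hcon
    refine absurd (hεlt k) (not_lt.2 ?_)
    have hnn : (0 : EReal) ≤ ((ρ k / G k k : ℝ) : EReal) := by
      exact_mod_cast (div_pos (hρpos k) (hGpos k)).le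
    refine (mul_le_mul_of_nonneg_left hcon hnn).trans ?_
    rw [← EReal.coe_mul, EReal.coe_le_coe_iff]
    have := (hGpos k).ne'
    have := (hρpos k).ne'
    refine le_of_eq ?_
    simp only [hx]
    field_simp
  have hlog : ∀ j k, Rrho P ρ * x j k ≤ Real.log (1 + x j k) := by
    intro j k
    refine mul_le_log_of_lt_xrho (hx0 j k) (lt_of_le_of_lt ?_ (hdiag k))
    rw [EReal.coe_le_coe_iff]
    exact div_le_div_of_nonneg_right
      (mul_le_mul_of_nonneg_left (green_le_diag hP hP0 hG1 hG2 hGnn j k) hε.le) (hρpos k).le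
  refine ⟨fun i => hx0 i i, fun i v hv hv0 hvi => ?_⟩
  simp only [hgv]
  have hsup : ∀ k, ∑ j, Real.log (1 + x j k) * v j ≤ ⨆ l, ∑ j, Real.log (1 + x j l) * v j :=
    fun k => le_ciSup (f := fun l => ∑ j, Real.log (1 + x j l) * v j)
      (Set.finite_range _).bddAbove k
  by_cases hz : ∀ j, x j i * v j = 0
  · obtain ⟨m, hm⟩ := Function.ne_iff.1 hv0
    have hvm : 0 < v m := lt_of_le_of_ne (hv m) (Ne.symm hm)
    have hxm : 0 < x m m := div_pos (mul_pos hε (hGpos m)) (hρpos m)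
    have hlhs : ∑ j, Real.log (1 + x j i) * v j = 0 := by
      refine Finset.sum_eq_zero fun j _ => ?_
      rcases mul_eq_zero.1 (hz j) with h | h <;> simp [h]
    rw [hlhs]
    refine lt_of_lt_of_le ?_ (hsup m)
    exact Finset.sum_pos'
      (fun j _ => mul_nonneg (Real.log_nonneg (by linarith [hx0 j m])) (hv j))
      ⟨m, Finset.mem_univ m, mul_pos (Real.log_pos (by linarith)) hvm⟩
  · push Not at hz
    obtain ⟨m, hm⟩ := hz
    have hxm : 0 < x m i := lt_of_le_of_ne (hx0 m i) (Ne.symm (left_ne_zero_of_mul hm))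
    have hvm : 0 < v m := lt_of_le_of_ne (hv m) (Ne.symm (right_ne_zero_of_mul hm))
    have hlogle : ∀ j, Real.log (1 + x j i) ≤ x j i := fun j => by
      linarith [Real.log_le_sub_one_of_pos (by linarith [hx0 j i] : 0 < 1 + x j i)]
    have hlt : ∑ j, Real.log (1 + x j i) * v j < ∑ j, x j i * v j := by
      refine Finset.sum_lt_sum (fun j _ => mul_le_mul_of_nonneg_right (hlogle j) (hv j))
        ⟨m, Finset.mem_univ m, mul_lt_mul_of_pos_right ?_ hvm⟩
      linarith [Real.log_lt_sub_one_of_pos (by linarith : 0 < 1 + x m i) (by linarith)]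
    have hrec : ∀ j, j ≠ i → x j i = ∑ k, x j k * (ρ k * P k i / ρ i) := by
      intro j hji
      have h1 := hG1 j i
      simp only [mul_sub, Finset.sum_sub_distrib, if_neg hji, mul_ite, mul_one, mul_zero,
        Finset.sum_ite_eq', Finset.mem_univ, if_true] at h1
      simp only [hx]
      rw [sub_eq_zero.1 h1, Finset.mul_sum, Finset.sum_div]
      refine Finset.sum_congr rfl fun k _ => ?_
      have := (hρpos k).ne'
      field_simp
    have hT : ∑ j, x j i * v j = ∑ k, (ρ k * P k i / ρ i) * ∑ j, x j k * v j := by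
      simp only [Finset.mul_sum]
      rw [Finset.sum_comm]
      refine Finset.sum_congr rfl fun j _ => ?_
      by_cases hji : j = i
      · simp [hji, hvi]
      · rw [hrec j hji, Finset.sum_mul]
        exact Finset.sum_congr rfl fun k _ => by ring
    have : Nonempty (Fin d) := ⟨i⟩
    obtain ⟨n, hn⟩ := Finite.exists_max fun k => ∑ j, x j k * v j
    have hTn : 0 ≤ ∑ j, x j n * v j := Finset.sum_nonneg fun j _ => mul_nonneg (hx0 j n) (hv j)
    refine hlt.trans_le (hT.trans_le ?_)
    calc ∑ k, (ρ k * P k i / ρ i) * ∑ j, x j k * v j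
        ≤ ∑ k, (ρ k * P k i / ρ i) * ∑ j, x j n * v j :=
          Finset.sum_le_sum fun k _ => mul_le_mul_of_nonneg_left (hn k)
            (div_nonneg (mul_nonneg (hρpos k).le (hP k i)) (hρpos i).le)
      _ = ((∑ k, ρ k * P k i) / ρ i) * ∑ j, x j n * v j := by
          rw [← Finset.sum_mul, Finset.sum_div]
      _ ≤ Rrho P ρ * ∑ j, x j n * v j :=
          mul_le_mul_of_nonneg_right
            (le_ciSup (f := fun i => (∑ j, ρ j * P j i) / ρ i) (Set.finite_range _).bddAbove i)
            hTn
      _ = ∑ j, (Rrho P ρ * x j n) * v j := by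
          simp only [Finset.mul_sum, mul_assoc]
      _ ≤ ∑ j, Real.log (1 + x j n) * v j :=
          Finset.sum_le_sum fun j _ => mul_le_mul_of_nonneg_right (hlog j n) (hv j)
      _ ≤ _ := hsup n
end

section
/- Under Assumptions (A) and (B), max_{1≤i≤d} inf_{α ∈ B_{{i}}} R(α) = − min_{1≤i≤d} (1/G_{ii}) (√μ_i − √ν_i)². -/
open scoped BigOperators
open Filter

/-- The Laplace transform R_Λ of the jump distribution on the face Λ. -/
noncomputable def RLam {d : ℕ} (lam mu : Fin d → ℝ) (P : Fin d → Fin d → ℝ)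
    (Λ : Finset (Fin d)) (α : Fin d → ℝ) : ℝ :=
  (∑ j, lam j * (Real.exp (α j) - 1))
    + ∑ j ∈ Λ, mu j *
        ((∑ k, P j k * Real.exp (α k - α j)) + (1 - ∑ k, P j k) * Real.exp (-α j) - 1)

/-- The set B_Λ of α with exp(α_i) ≤ Σ_j p_{ij} exp(α_j) + p_{i0} for all i ∉ Λ. -/
def BLam {d : ℕ} (P : Fin d → Fin d → ℝ) (Λ : Finset (Fin d)) : Set (Fin d → ℝ) :=
  {α | ∀ i ∉ Λ, Real.exp (α i) ≤ (∑ j, P i j * Real.exp (α j)) + (1 - ∑ j, P i j)}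

/-- Minimum principle: a vector that is nonnegative at `i` and superharmonic for `P` off `i` is
nonnegative, provided `Id - P` has a nonnegative left inverse. -/
theorem nonneg_of_superharmonic_off {ι : Type*} [Fintype ι] [DecidableEq ι] {P G : ι → ι → ℝ}
    (hP : ∀ i j, 0 ≤ P i j) (hGnn : ∀ i j, 0 ≤ G i j)
    (hG : ∀ i k, ∑ j, G i j * ((if j = k then (1 : ℝ) else 0) - P j k) = if i = k then 1 else 0)
    {v : ι → ℝ} {i : ι} (hi : 0 ≤ v i) (hv : ∀ j ≠ i, ∑ k, P j k * v k ≤ v j) (j : ι) :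
    0 ≤ v j := by
  set n : ι → ℝ := fun k => max (-v k) 0 with hn
  have hn0 : ∀ k, 0 ≤ n k := fun k => le_max_right _ _
  have hsub : ∀ k, n k ≤ ∑ l, P k l * n l := by
    intro k
    have hnn : 0 ≤ ∑ l, P k l * n l := Finset.sum_nonneg fun l _ => mul_nonneg (hP k l) (hn0 l)
    refine max_le ?_ hnn
    by_cases hk : k = i
    · subst hk; linarith
    · calc -v k ≤ -∑ l, P k l * v l := neg_le_neg (hv k hk)
        _ = ∑ l, P k l * (-v l) := by simp
        _ ≤ ∑ l, P k l * n l :=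
          Finset.sum_le_sum fun l _ => mul_le_mul_of_nonneg_left (le_max_left _ _) (hP k l)
  have hrep : n j = ∑ k, G j k * (n k - ∑ l, P k l * n l) := by
    have h1 : ∑ l, (∑ k, G j k * ((if k = l then (1 : ℝ) else 0) - P k l)) * n l = n j := by
      simp [hG]
    rw [← h1]
    simp_rw [Finset.sum_mul]
    rw [Finset.sum_comm]
    refine Finset.sum_congr rfl fun k _ => ?_
    have h2 : n k = ∑ l, (if k = l then (1 : ℝ) else 0) * n l := by simp
    conv_rhs => rw [h2]
    rw [← Finset.sum_sub_distrib, Finset.mul_sum]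
    exact Finset.sum_congr rfl fun l _ => by ring
  have hle : n j ≤ 0 := by
    rw [hrep]
    exact Finset.sum_nonpos fun k _ =>
      mul_nonpos_of_nonneg_of_nonpos (hGnn j k) (sub_nonpos.2 (hsub k))
  have : -v j ≤ n j := le_max_left _ _
  linarith

/-- If the jump rates tilted by `h` balance at every node, then `log h` is a global minimum of
the Laplace transform of the network with service rates `m * h`. -/
theorem le_RLam_of_balance {d : ℕ} {lam m h : Fin d → ℝ} {P : Fin d → Fin d → ℝ}
    (hlam : ∀ i, 0 ≤ lam i) (hP : ∀ i j, 0 ≤ P i j) (hP0 : ∀ i, ∑ j, P i j ≤ 1)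
    (hm : ∀ i, 0 ≤ m i) (hh : ∀ i, 0 < h i)
    (hbal : ∀ j, h j * (lam j + ∑ k, m k * P k j)
      = m j * (∑ l, P j l * h l + (1 - ∑ l, P j l))) (α : Fin d → ℝ) :
    ∑ j, lam j * (h j - 1) + ∑ k, m k * (∑ l, P k l * h l + (1 - ∑ l, P k l) - h k)
      ≤ RLam lam (fun k => m k * h k) P Finset.univ α := by
  set β : Fin d → ℝ := fun k => α k - Real.log (h k) with hβ
  have hα : ∀ k, α k = β k + Real.log (h k) := fun k => by simp [hβ]
  have hlin : ∑ j, lam j * (h j * β j)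
      + ∑ k, m k * (∑ l, P k l * (h l * (β l - β k)) + (1 - ∑ l, P k l) * (-β k)) = 0 := by
    have h1 : ∀ k, m k * (∑ l, P k l * (h l * (β l - β k)) + (1 - ∑ l, P k l) * (-β k))
        = ∑ l, m k * P k l * (h l * β l)
          - β k * (m k * (∑ l, P k l * h l + (1 - ∑ l, P k l))) := by
      intro k
      have h2 : ∑ l, P k l * (h l * (β l - β k))
          = ∑ l, P k l * (h l * β l) - β k * ∑ l, P k l * h l := by
        rw [Finset.mul_sum, ← Finset.sum_sub_distrib]
        exact Finset.sum_congr rfl fun l _ => by ring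
      rw [h2]
      simp_rw [mul_assoc (m k), ← Finset.mul_sum]
      ring
    simp_rw [h1, Finset.sum_sub_distrib, ← hbal]
    rw [Finset.sum_comm, ← add_sub_assoc, ← Finset.sum_add_distrib, ← Finset.sum_sub_distrib]
    refine Finset.sum_eq_zero fun j _ => ?_
    rw [← Finset.sum_mul]
    ring
  have harr : ∀ j, lam j * (h j - 1) + lam j * (h j * β j) ≤ lam j * (Real.exp (α j) - 1) := by
    intro j
    rw [hα j, Real.exp_add, Real.exp_log (hh j), ← mul_add]
    refine mul_le_mul_of_nonneg_left ?_ (hlam j)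
    nlinarith [mul_le_mul_of_nonneg_left (Real.add_one_le_exp (β j)) (hh j).le]
  have hserv : ∀ k, m k * (∑ l, P k l * h l + (1 - ∑ l, P k l) - h k)
      + m k * (∑ l, P k l * (h l * (β l - β k)) + (1 - ∑ l, P k l) * (-β k))
      ≤ m k * h k *
        ((∑ l, P k l * Real.exp (α l - α k)) + (1 - ∑ l, P k l) * Real.exp (-α k) - 1) := by
    intro k
    rw [← mul_add, mul_assoc]
    refine mul_le_mul_of_nonneg_left ?_ (hm k)
    have hexp : ∀ l, h k * Real.exp (α l - α k) = h l * Real.exp (β l - β k) := by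
      intro l
      rw [hα l, hα k, Real.exp_sub, Real.exp_sub, Real.exp_add, Real.exp_add,
        Real.exp_log (hh l), Real.exp_log (hh k)]
      have := (hh k).ne'
      field_simp
    have hexp0 : h k * Real.exp (-α k) = Real.exp (-β k) := by
      rw [hα k, neg_add, Real.exp_add, Real.exp_neg (Real.log (h k)), Real.exp_log (hh k)]
      have := (hh k).ne'
      field_simp
    have h1 : h k * ∑ l, P k l * Real.exp (α l - α k)
        = ∑ l, P k l * (h l * Real.exp (β l - β k)) := by
      rw [Finset.mul_sum]
      exact Finset.sum_congr rfl fun l _ => by rw [← hexp l]; ring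
    have h2 : ∑ l, P k l * h l + ∑ l, P k l * (h l * (β l - β k))
        ≤ ∑ l, P k l * (h l * Real.exp (β l - β k)) := by
      rw [← Finset.sum_add_distrib]
      refine Finset.sum_le_sum fun l _ => ?_
      rw [← mul_add]
      refine mul_le_mul_of_nonneg_left ?_ (hP k l)
      nlinarith [mul_le_mul_of_nonneg_left (Real.add_one_le_exp (β l - β k)) (hh l).le]
    have h3 := mul_le_mul_of_nonneg_left (Real.add_one_le_exp (-β k)) (sub_nonneg.2 (hP0 k))
    rw [← hexp0] at h3
    rw [← h1] at h2
    linarith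
  have hsum := add_le_add (Finset.sum_le_sum fun j (_ : j ∈ Finset.univ) => harr j)
    (Finset.sum_le_sum fun k (_ : k ∈ Finset.univ) => hserv k)
  rw [Finset.sum_add_distrib, Finset.sum_add_distrib] at hsum
  unfold RLam
  linarith

/-- The Laplace transform at a logarithm. -/
theorem RLam_log {d : ℕ} {lam mu h : Fin d → ℝ} {P : Fin d → Fin d → ℝ} (hh : ∀ i, 0 < h i) :
    RLam lam mu P Finset.univ (fun k => Real.log (h k))
      = ∑ j, lam j * (h j - 1)
        + ∑ k, mu k / h k * (∑ l, P k l * h l + (1 - ∑ l, P k l) - h k) := by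
  unfold RLam
  refine congrArg₂ _ (Finset.sum_congr rfl fun j _ => by rw [Real.exp_log (hh j)])
    (Finset.sum_congr rfl fun k _ => ?_)
  have hk := (hh k).ne'
  have h1 : ∑ l, P k l * Real.exp (Real.log (h l) - Real.log (h k))
      = (∑ l, P k l * h l) / h k := by
    rw [Finset.sum_div]
    refine Finset.sum_congr rfl fun l _ => ?_
    rw [Real.exp_sub, Real.exp_log (hh l), Real.exp_log (hh k), mul_div_assoc]
  rw [h1, Real.exp_neg, Real.exp_log (hh k)]
  field_simp

/-- The Laplace transform is bounded below. -/
theorem neg_sum_le_RLam {d : ℕ} {lam mu : Fin d → ℝ} {P : Fin d → Fin d → ℝ}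
    (hlam : ∀ i, 0 ≤ lam i) (hmu : ∀ i, 0 ≤ mu i)
    (hP : ∀ i j, 0 ≤ P i j) (hP0 : ∀ i, ∑ j, P i j ≤ 1) (Λ : Finset (Fin d)) (α : Fin d → ℝ) :
    -∑ j, lam j - ∑ j ∈ Λ, mu j ≤ RLam lam mu P Λ α := by
  unfold RLam
  rw [sub_eq_add_neg, ← Finset.sum_neg_distrib, ← Finset.sum_neg_distrib]
  refine add_le_add (Finset.sum_le_sum fun j _ => ?_) (Finset.sum_le_sum fun j _ => ?_)
  · nlinarith [mul_nonneg (hlam j) (Real.exp_pos (α j)).le]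
  · have h1 : 0 ≤ ∑ k, P j k * Real.exp (α k - α j) :=
      Finset.sum_nonneg fun k _ => mul_nonneg (hP j k) (Real.exp_pos _).le
    have h2 : 0 ≤ (1 - ∑ k, P j k) * Real.exp (-α j) :=
      mul_nonneg (sub_nonneg.2 (hP0 j)) (Real.exp_pos _).le
    nlinarith [mul_nonneg (hmu j) (add_nonneg h1 h2)]

/-- On `BLam P {i}`, lowering the service rates off `i` lowers the Laplace transform. -/
theorem RLam_mono_of_mem_BLam {d : ℕ} {lam mu mu' : Fin d → ℝ} {P : Fin d → Fin d → ℝ}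
    {i : Fin d} (hi : mu' i = mu i) (hle : ∀ k, mu' k ≤ mu k) {α : Fin d → ℝ}
    (hα : α ∈ BLam P {i}) :
    RLam lam mu' P Finset.univ α ≤ RLam lam mu P Finset.univ α := by
  unfold RLam
  refine add_le_add le_rfl (Finset.sum_le_sum fun k _ => ?_)
  by_cases hk : k = i
  · subst hk; rw [hi]
  refine mul_le_mul_of_nonneg_right (hle k) ?_
  have h1 := mul_le_mul_of_nonneg_left (hα k (by simpa using hk)) (Real.exp_pos (-α k)).le
  rw [← Real.exp_add, neg_add_cancel, Real.exp_zero, mul_add, Finset.mul_sum] at h1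
  have h2 : ∑ l, Real.exp (-α k) * (P k l * Real.exp (α l))
      = ∑ l, P k l * Real.exp (α l - α k) := by
    refine Finset.sum_congr rfl fun l _ => ?_
    rw [sub_eq_add_neg, Real.exp_add]
    ring
  rw [h2] at h1
  linarith

section Potential

variable {d : ℕ} {lam ν : Fin d → ℝ} {P G : Fin d → Fin d → ℝ}

theorem sum_mul_potential
    (hG2 : ∀ i k, ∑ j, ((if i = j then (1 : ℝ) else 0) - P i j) * G j k
      = if i = k then 1 else 0) (i k : Fin d) :
    ∑ j, P k j * G j i = G k i - if k = i then 1 else 0 := by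
  rw [← hG2 k i]
  simp [sub_mul, Finset.sum_sub_distrib]

theorem sum_potential_mul
    (hG1 : ∀ i k, ∑ j, G i j * ((if j = k then (1 : ℝ) else 0) - P j k)
      = if i = k then 1 else 0) (i k : Fin d) :
    ∑ j, G i j * P j k = G i k - if i = k then 1 else 0 := by
  rw [← hG1 i k]
  simp [mul_sub, Finset.sum_sub_distrib]

theorem sum_arrival_mul_potential
    (hG2 : ∀ i k, ∑ j, ((if i = j then (1 : ℝ) else 0) - P i j) * G j k
      = if i = k then 1 else 0)
    (hν : ∀ j, ν j = lam j + ∑ i, ν i * P i j) (i : Fin d) :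
    ∑ j, lam j * G j i = ν i := by
  have h1 : ∀ j, lam j * G j i = ν j * G j i - ∑ l, ν l * (P l j * G j i) := by
    intro j
    rw [eq_sub_of_add_eq (hν j).symm, sub_mul, Finset.sum_mul]
    simp_rw [mul_assoc]
  simp_rw [h1]
  rw [Finset.sum_sub_distrib, Finset.sum_comm]
  simp_rw [← Finset.mul_sum, sum_mul_potential hG2, mul_sub]
  simp [Finset.sum_sub_distrib]

theorem potential_le_diag (hP : ∀ i j, 0 ≤ P i j) (hP0 : ∀ i, ∑ j, P i j ≤ 1)
    (hG1 : ∀ i k, ∑ j, G i j * ((if j = k then (1 : ℝ) else 0) - P j k)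
      = if i = k then 1 else 0)
    (hG2 : ∀ i k, ∑ j, ((if i = j then (1 : ℝ) else 0) - P i j) * G j k
      = if i = k then 1 else 0)
    (hGnn : ∀ i j, 0 ≤ G i j) (k i : Fin d) : G k i ≤ G i i := by
  have := nonneg_of_superharmonic_off (v := fun j => G i i - G j i) (i := i) hP hGnn hG1
    (by simp) (fun j hj => by
      simp_rw [mul_sub, Finset.sum_sub_distrib, sum_mul_potential hG2, if_neg hj,
        ← Finset.sum_mul]
      nlinarith [mul_le_mul_of_nonneg_right (hP0 j) (hGnn i i)]) k
  linarith

theorem traffic_mul_potential_le (hlam : ∀ i, 0 ≤ lam i) (hP : ∀ i j, 0 ≤ P i j)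
    (hG1 : ∀ i k, ∑ j, G i j * ((if j = k then (1 : ℝ) else 0) - P j k)
      = if i = k then 1 else 0)
    (hG2 : ∀ i k, ∑ j, ((if i = j then (1 : ℝ) else 0) - P i j) * G j k
      = if i = k then 1 else 0)
    (hGnn : ∀ i j, 0 ≤ G i j)
    (hν : ∀ j, ν j = lam j + ∑ i, ν i * P i j) (k i : Fin d) :
    ν k * G k i ≤ ν i * G k k := by
  have := nonneg_of_superharmonic_off (P := fun a b => P b a) (G := fun a b => G b a)
    (v := fun j => ν j * G k k - ν k * G k j) (i := k) (fun a b => hP b a) (fun a b => hGnn b a)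
    (fun a b => by simpa [mul_comm, eq_comm] using hG2 b a)
    (by simp) (fun j hj => by
      have h1 : ∑ l, P l j * (ν l * G k k - ν k * G k l)
          = G k k * ∑ l, ν l * P l j - ν k * ∑ l, G k l * P l j := by
        rw [Finset.mul_sum, Finset.mul_sum, ← Finset.sum_sub_distrib]
        exact Finset.sum_congr rfl fun l _ => by ring
      rw [h1, sum_potential_mul hG1, if_neg (Ne.symm hj)]
      have h2 : ν j * G k k = lam j * G k k + G k k * ∑ l, ν l * P l j := by
        linear_combination G k k * hν j
      linarith [mul_nonneg (hlam j) (hGnn k k)]) i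
  linarith

end Potential

/-- A hitting-type quantity `g ≤ A` with `n * g ≤ n' * B` is controlled by the comparison of the
two normalized gaps. -/
theorem mul_div_le_of_gap_le {g A B n n' a b : ℝ} (hg : 0 ≤ g) (hA : 0 < A) (hn : 0 < n)
    (hb : 0 ≤ b) (hgA : g ≤ A) (hgB : n * g ≤ n' * B)
    (hab : n' * a ^ 2 * B ≤ n * b ^ 2 * A) : a / A * g ≤ b := by
  refine le_of_sq_le_sq ?_ hb
  have h1 : n * g * g ≤ n' * B * A := by
    calc n * g * g ≤ n * g * A := mul_le_mul_of_nonneg_left hgA (by positivity)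
      _ ≤ n' * B * A := mul_le_mul_of_nonneg_right hgB hA.le
  have h2 : (a / A * g) ^ 2 = a ^ 2 * (n * g * g) / (n * A ^ 2) := by
    field_simp
  rw [h2, div_le_iff₀ (by positivity)]
  calc a ^ 2 * (n * g * g) ≤ a ^ 2 * (n' * B * A) := mul_le_mul_of_nonneg_left h1 (sq_nonneg a)
    _ = (n' * a ^ 2 * B) * A := by ring
    _ ≤ (n * b ^ 2 * A) * A := mul_le_mul_of_nonneg_right hab hA.le
    _ = b ^ 2 * (n * A ^ 2) := by ring

/-- Equality (7.2): max_i inf_{α ∈ B_{{i}}} R(α) = - min_i (1/G_ii)(√μ_i - √ν_i)². -/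
theorem stmt5
    (d : ℕ) (hd : 0 < d)
    (lam mu : Fin d → ℝ) (P : Fin d → Fin d → ℝ)
    (hlam : ∀ i, 0 ≤ lam i) (hmu : ∀ i, 0 < mu i)
    (hP : ∀ i j, 0 ≤ P i j) (hPdiag : ∀ i, P i i = 0) (hP0 : ∀ i, ∑ j, P i j ≤ 1)
    (hA : AssumptionA lam mu P)
    (G : Fin d → Fin d → ℝ)
    (hG1 : ∀ i k, ∑ j, G i j * ((if j = k then (1 : ℝ) else 0) - P j k)
      = if i = k then 1 else 0)
    (hG2 : ∀ i k, ∑ j, ((if i = j then (1 : ℝ) else 0) - P i j) * G j k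
      = if i = k then 1 else 0)
    (hGnn : ∀ i j, 0 ≤ G i j) (hGdiag : ∀ i, 1 ≤ G i i)
    (ν : Fin d → ℝ) (hν : ∀ j, ν j = lam j + ∑ i, ν i * P i j) (hνpos : ∀ i, 0 < ν i)
    (hB : ∀ i, ν i < mu i)
    : (⨆ i : Fin d, sInf (RLam lam mu P Finset.univ '' BLam P {i}))
      = - ⨅ i : Fin d, 1 / G i i * (Real.sqrt (mu i) - Real.sqrt (ν i)) ^ 2 := by
  have : Nonempty (Fin d) := ⟨⟨0, hd⟩⟩
  set a : Fin d → ℝ := fun i => Real.sqrt (mu i) / Real.sqrt (ν i) - 1 with ha_def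
  have hGpos : ∀ i, 0 < G i i := fun i => one_pos.trans_le (hGdiag i)
  have hsν : ∀ i, 0 < Real.sqrt (ν i) := fun i => Real.sqrt_pos.2 (hνpos i)
  have ha : ∀ i, 0 ≤ a i := fun i => by
    rw [ha_def, sub_nonneg, one_le_div (hsν i)]
    exact Real.sqrt_le_sqrt (hB i).le
  have hmua : ∀ i, mu i = ν i * (1 + a i) ^ 2 := fun i => by
    have h1 : 1 + a i = Real.sqrt (mu i) / Real.sqrt (ν i) := by simp [ha_def]
    rw [h1, div_pow, Real.sq_sqrt (hmu i).le, Real.sq_sqrt (hνpos i).le]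
    have := (hνpos i).ne'
    field_simp
  have hgap : ∀ i, (Real.sqrt (mu i) - Real.sqrt (ν i)) ^ 2 = ν i * a i ^ 2 := fun i => by
    have h1 : Real.sqrt (mu i) - Real.sqrt (ν i) = Real.sqrt (ν i) * a i := by
      have := (hsν i).ne'
      simp only [ha_def]
      field_simp
    rw [h1, mul_pow, Real.sq_sqrt (hνpos i).le]
  set h : Fin d → Fin d → ℝ := fun i j => 1 + a i / G i i * G j i with hh_def
  set m : Fin d → Fin d → ℝ := fun i k => ν k + a i / G i i * (ν i * G i k) with hm_def
  have he : ∀ i, 0 ≤ a i / G i i := fun i => div_nonneg (ha i) (hGpos i).le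
  have hhpos : ∀ i j, 0 < h i j := fun i j =>
    add_pos_of_pos_of_nonneg one_pos (mul_nonneg (he i) (hGnn j i))
  have hmpos : ∀ i k, 0 < m i k := fun i k =>
    add_pos_of_pos_of_nonneg (hνpos k) (mul_nonneg (he i) (mul_nonneg (hνpos i).le (hGnn i k)))
  have hdiag : ∀ i, a i / G i i * G i i = a i := fun i => div_mul_cancel₀ _ (hGpos i).ne'
  have hhi : ∀ i, h i i = 1 + a i := fun i => by simp only [hh_def, hdiag]
  have hmi : ∀ i, m i i = ν i * (1 + a i) := fun i => by
    simp only [hm_def]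
    linear_combination ν i * hdiag i
  have hharm : ∀ i k, ∑ l, P k l * h i l + (1 - ∑ l, P k l)
      = h i k - a i / G i i * (if k = i then 1 else 0) := fun i k => by
    have h1 : ∑ l, P k l * h i l = ∑ l, P k l + a i / G i i * ∑ l, P k l * G l i := by
      rw [Finset.mul_sum, ← Finset.sum_add_distrib]
      exact Finset.sum_congr rfl fun l _ => by simp only [hh_def]; ring
    rw [h1, sum_mul_potential hG2]
    simp only [hh_def]
    ring
  have hinv : ∀ i j, lam j + ∑ k, m i k * P k j
      = m i j - a i / G i i * ν i * (if i = j then 1 else 0) := fun i j => by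
    have h1 : ∑ k, m i k * P k j
        = ∑ k, ν k * P k j + a i / G i i * ν i * ∑ k, G i k * P k j := by
      rw [Finset.mul_sum, ← Finset.sum_add_distrib]
      exact Finset.sum_congr rfl fun l _ => by simp only [hm_def]; ring
    rw [h1, sum_potential_mul hG1]
    simp only [hm_def]
    linear_combination -hν j
  have hval : ∀ i (w : Fin d → ℝ), w i = m i i →
      ∑ j, lam j * (h i j - 1) + ∑ k, w k * (∑ l, P k l * h i l + (1 - ∑ l, P k l) - h i k)
        = -(1 / G i i * (Real.sqrt (mu i) - Real.sqrt (ν i)) ^ 2) := by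
    intro i w hw
    have h1 : ∑ j, lam j * (h i j - 1) = a i / G i i * ν i := by
      rw [← sum_arrival_mul_potential hG2 hν i, Finset.mul_sum]
      exact Finset.sum_congr rfl fun l _ => by simp only [hh_def]; ring
    have h2 : ∑ k, w k * (∑ l, P k l * h i l + (1 - ∑ l, P k l) - h i k)
        = -(a i / G i i * m i i) := by
      simp_rw [hharm]
      rw [← hw]
      simp [mul_comm]
    rw [h1, h2, hmi, hgap]
    ring
  have hbdd : ∀ i, BddBelow (RLam lam mu P Finset.univ '' BLam P {i}) := fun i => by
    refine ⟨-∑ j, lam j - ∑ j, mu j, ?_⟩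
    rintro _ ⟨α, -, rfl⟩
    exact neg_sum_le_RLam hlam (fun i => (hmu i).le) hP hP0 _ α
  have hmem : ∀ i, (fun k => Real.log (h i k)) ∈ BLam P {i} := fun i k hk => by
    simp only [Real.exp_log (hhpos i _)]
    rw [hharm, if_neg (by simpa using hk), mul_zero, sub_zero]
  have hupper : ∀ i, sInf (RLam lam mu P Finset.univ '' BLam P {i})
      ≤ -(1 / G i i * (Real.sqrt (mu i) - Real.sqrt (ν i)) ^ 2) := fun i => by
    refine csInf_le (hbdd i) ⟨_, hmem i, ?_⟩
    rw [RLam_log (hhpos i)]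
    refine hval i (fun k => mu k / h i k) ?_
    have := (hhpos i i).ne'
    rw [hhi] at this
    simp only [hmua i, hhi, hmi]
    field_simp
  refine le_antisymm (ciSup_le fun i => (hupper i).trans
    (neg_le_neg (ciInf_le (Set.finite_range _).bddBelow i))) ?_
  obtain ⟨i, hi⟩ := exists_eq_ciInf_of_finite
    (f := fun i : Fin d => 1 / G i i * (Real.sqrt (mu i) - Real.sqrt (ν i)) ^ 2)
  rw [← hi]
  have hmin : ∀ k, ν i * a i ^ 2 * G k k ≤ ν k * a k ^ 2 * G i i := fun k => by
    have h1 := hi.trans_le (ciInf_le (Set.finite_range _).bddBelow k)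
    simp only [hgap] at h1
    rwa [one_div_mul_eq_div, one_div_mul_eq_div, div_le_div_iff₀ (hGpos i) (hGpos k)] at h1
  have hmule : ∀ k, m i k * h i k ≤ mu k := fun k => by
    have hq : a i / G i i * G k i ≤ a k :=
      mul_div_le_of_gap_le (hGnn k i) (hGpos i) (hνpos k) (ha k)
        (potential_le_diag hP hP0 hG1 hG2 hGnn k i)
        (traffic_mul_potential_le hlam hP hG1 hG2 hGnn hν k i) (hmin k)
    have ht : a i / G i i * (ν i * G i k / ν k) ≤ a k :=
      mul_div_le_of_gap_le (div_nonneg (mul_nonneg (hνpos i).le (hGnn i k)) (hνpos k).le)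
        (hGpos i) (hνpos k) (ha k)
        ((div_le_iff₀ (hνpos k)).2 (by
          linarith [traffic_mul_potential_le hlam hP hG1 hG2 hGnn hν i k]))
        (by
          rw [mul_div_cancel₀ _ (hνpos k).ne']
          exact mul_le_mul_of_nonneg_left (potential_le_diag hP hP0 hG1 hG2 hGnn i k)
            (hνpos i).le)
        (hmin k)
    have h1 : m i k = ν k * (1 + a i / G i i * (ν i * G i k / ν k)) := by
      have := (hνpos k).ne'
      have := (hGpos i).ne'
      simp only [hm_def]
      field_simp
    rw [h1, hmua k, mul_assoc, sq]
    refine mul_le_mul_of_nonneg_left ?_ (hνpos k).le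
    exact mul_le_mul (by linarith) (by simp only [hh_def]; linarith) (hhpos i k).le
      (by linarith [ha k])
  refine le_trans ?_ (le_ciSup (f := fun i => sInf (RLam lam mu P Finset.univ '' BLam P {i}))
    (Set.finite_range _).bddAbove i)
  refine le_csInf ⟨_, _, hmem i, rfl⟩ ?_
  rintro _ ⟨α, hα, rfl⟩
  refine le_trans ?_ (RLam_mono_of_mem_BLam (mu' := fun k => m i k * h i k) ?_ hmule hα)
  · rw [← hval i (m i) rfl]
    refine le_RLam_of_balance hlam hP hP0 (fun k => (hmpos i k).le) (hhpos i) (fun j => ?_) α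
    rw [hinv, hharm]
    by_cases hj : j = i
    · subst hj
      rw [hhi, hmi]
      simp only [if_true]
      ring
    · simp [hj, Ne.symm hj, mul_comm]
  · simp only [hmi, hhi, hmua i]
    ring
end

section
/- Under Assumptions (A) and (B), suppose the routing matrix P has a branching structure. Then for every ε > 0 and every ρ ∈ ℝ^d satisfying (ρP)_i < ρ_i for all i, the vector γ defined by γ_i = ε G_{ii}/ρ_i belongs to Γ. -/
open scoped BigOperators
open Filter

/-- A matrix A = (a_{ji}) has a branching structure if for every i the set
{j : a_{ji} > 0} contains at most one element. -/
def Branching {d : ℕ} (P : Fin d → Fin d → ℝ) : Prop :=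
  ∀ i j k : Fin d, 0 < P j i → 0 < P k i → j = k

/-- If `G` is a nonnegative right inverse of `1 - P` with diagonal entries at least one, then every
vector `ρ` with `ρ P < ρ` componentwise is positive. -/
theorem pos_of_strict_excessive {d : ℕ} {P G : Fin d → Fin d → ℝ}
    (hG2 : ∀ i k, ∑ j, ((if i = j then (1 : ℝ) else 0) - P i j) * G j k = if i = k then 1 else 0)
    (hGnn : ∀ i j, 0 ≤ G i j) (hGdiag : ∀ i, 1 ≤ G i i)
    {ρ : Fin d → ℝ} (hρ : ∀ i, ∑ j, ρ j * P j i < ρ i) (k : Fin d) : 0 < ρ k := by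
  have h : ∑ i, (ρ i - ∑ j, ρ j * P j i) * G i k = ρ k := by
    calc ∑ i, (ρ i - ∑ j, ρ j * P j i) * G i k
        = ∑ i, ∑ j, ρ j * (((if j = i then (1 : ℝ) else 0) - P j i) * G i k) := by
          refine Finset.sum_congr rfl fun i _ => ?_
          simp_rw [← mul_assoc, ← Finset.sum_mul, mul_sub, Finset.sum_sub_distrib]
          simp
      _ = ρ k := by
          rw [Finset.sum_comm]
          simp_rw [← Finset.mul_sum, hG2]
          simp
  rw [← h]
  refine Finset.sum_pos' (fun i _ => mul_nonneg (sub_nonneg.2 (hρ i).le) (hGnn i k))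
    ⟨k, Finset.mem_univ k, mul_pos (sub_pos.2 (hρ k)) (by linarith [hGdiag k])⟩

/-- A left inverse `G` of `1 - P` satisfies the renewal equation `G = 1 + G P`. -/
theorem renewal_of_left_inverse {d : ℕ} {P G : Fin d → Fin d → ℝ}
    (hG1 : ∀ i k, ∑ j, G i j * ((if j = k then (1 : ℝ) else 0) - P j k) = if i = k then 1 else 0)
    (i k : Fin d) : G i k = (if i = k then 1 else 0) + ∑ j, G i j * P j k := by
  have h := hG1 i k
  simp only [mul_sub, Finset.sum_sub_distrib, mul_ite, mul_one, mul_zero, Finset.sum_ite_eq',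
    Finset.mem_univ, if_true] at h
  linarith

/-- In a branching structure, the column of `G` at a node `l` with parent `k` is, off the diagonal,
the column at `k` scaled by `P k l`. -/
theorem renewal_of_branching {d : ℕ} {P G : Fin d → Fin d → ℝ} (hP : ∀ i j, 0 ≤ P i j)
    (hren : ∀ i k, G i k = (if i = k then 1 else 0) + ∑ j, G i j * P j k) (hB : Branching P)
    {k l : Fin d} (hk : 0 < P k l) {j : Fin d} (hj : j ≠ l) : G j l = G j k * P k l := by
  rw [hren j l, if_neg hj, zero_add]
  refine Finset.sum_eq_single k (fun m _ hm => ?_) (by simp)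
  have : P m l = 0 := by
    by_contra h0
    exact hm (hB l m k (lt_of_le_of_ne (hP m l) (Ne.symm h0)) hk)
  rw [this, mul_zero]

/-- Proposition 3.1: if the routing matrix has a branching structure, then for every
ε > 0 and every ρ with (ρP)_i < ρ_i for all i, the vector γ_i = ε G_ii / ρ_i
belongs to Γ. -/
theorem stmt7
    (d : ℕ) (hd : 0 < d)
    (lam mu : Fin d → ℝ) (P : Fin d → Fin d → ℝ)
    (hlam : ∀ i, 0 ≤ lam i) (hmu : ∀ i, 0 < mu i)
    (hP : ∀ i j, 0 ≤ P i j) (hPdiag : ∀ i, P i i = 0) (hP0 : ∀ i, ∑ j, P i j ≤ 1)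
    (hA : AssumptionA lam mu P)
    (G : Fin d → Fin d → ℝ)
    (hG1 : ∀ i k, ∑ j, G i j * ((if j = k then (1 : ℝ) else 0) - P j k)
      = if i = k then 1 else 0)
    (hG2 : ∀ i k, ∑ j, ((if i = j then (1 : ℝ) else 0) - P i j) * G j k
      = if i = k then 1 else 0)
    (hGnn : ∀ i j, 0 ≤ G i j) (hGdiag : ∀ i, 1 ≤ G i i)
    (ν : Fin d → ℝ) (hν : ∀ j, ν j = lam j + ∑ i, ν i * P i j) (hνpos : ∀ i, 0 < ν i)
    (hB : ∀ i, ν i < mu i)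
    (hB : Branching P) :
    ∀ ε : ℝ, 0 < ε → ∀ ρ : Fin d → ℝ, (∀ i, ∑ j, ρ j * P j i < ρ i) →
      (fun i => ε * G i i / ρ i) ∈ GammaSet d (hitQ G) := by
  intro ε hε ρ hρ
  have hρpos := pos_of_strict_excessive hG2 hGnn hGdiag hρ
  have hren := renewal_of_left_inverse hG1
  have hGpos : ∀ i, 0 < G i i := fun i => by linarith [hGdiag i]
  refine ⟨fun i => div_nonneg (mul_nonneg hε.le (hGnn i i)) (hρpos i).le, ?_⟩
  intro i v hv hv0 hvi
  have hg : ∀ l j, gvec (hitQ G) (fun i => ε * G i i / ρ i) l j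
      = Real.log (1 + ε * (G j l / ρ l)) := fun l j => by
    have := (hGpos l).ne'
    have := (hρpos l).ne'
    simp only [gvec, hitQ]
    congr 2
    field_simp
  simp_rw [hg]
  have hratio : ∀ l j, 0 ≤ ε * (G j l / ρ l) := fun l j =>
    mul_nonneg hε.le (div_nonneg (hGnn j l) (hρpos l).le)
  have hterm : ∀ l j, 0 ≤ Real.log (1 + ε * (G j l / ρ l)) * v j := fun l j =>
    mul_nonneg (Real.log_nonneg (by linarith [hratio l j])) (hv j)
  suffices h : ∃ l, ∑ j, Real.log (1 + ε * (G j i / ρ i)) * v j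
      < ∑ j, Real.log (1 + ε * (G j l / ρ l)) * v j by
    obtain ⟨l, hl⟩ := h
    exact hl.trans_le (le_ciSup (f := fun l => ∑ j, Real.log (1 + ε * (G j l / ρ l)) * v j)
      (Set.finite_range _).bddAbove l)
  by_cases hzero : ∀ j, Real.log (1 + ε * (G j i / ρ i)) * v j = 0
  · obtain ⟨l, hl⟩ := Function.ne_iff.1 hv0
    have hvl : 0 < v l := lt_of_le_of_ne (hv l) (Ne.symm hl)
    refine ⟨l, ?_⟩
    rw [Finset.sum_eq_zero fun j _ => hzero j]
    refine Finset.sum_pos' (fun j _ => hterm l j) ⟨l, Finset.mem_univ l, mul_pos ?_ hvl⟩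
    exact Real.log_pos (by linarith [mul_pos hε (div_pos (hGpos l) (hρpos l))])
  · push Not at hzero
    obtain ⟨j, hj⟩ := hzero
    have hvj : 0 < v j := lt_of_le_of_ne (hv j) fun h => hj (by rw [← h, mul_zero])
    have hji : j ≠ i := by
      rintro rfl
      exact hvj.ne' hvi
    have hGji : G j i ≠ 0 := fun h => hj (by simp [h])
    have hsum := hren j i
    rw [if_neg hji, zero_add] at hsum
    obtain ⟨k, -, hk⟩ := Finset.exists_ne_zero_of_sum_ne_zero (hsum ▸ hGji)
    have hPk : 0 < P k i := lt_of_le_of_ne (hP k i) (Ne.symm (right_ne_zero_of_mul hk))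
    have hGk : 0 < G j k := lt_of_le_of_ne (hGnn j k) (Ne.symm (left_ne_zero_of_mul hk))
    have hlt : P k i / ρ i < 1 / ρ k := by
      rw [div_lt_div_iff₀ (hρpos i) (hρpos k), one_mul, mul_comm]
      exact (Finset.single_le_sum (f := fun m => ρ m * P m i)
        (fun m _ => mul_nonneg (hρpos m).le (hP m i)) (Finset.mem_univ k)).trans_lt (hρ i)
    have hcol : ∀ m, m ≠ i → G m i / ρ i = G m k * (P k i / ρ i) := fun m hm => by
      rw [renewal_of_branching hP hren hB hPk hm, mul_div_assoc]
    refine ⟨k, Finset.sum_lt_sum (fun m _ => ?_) ⟨j, Finset.mem_univ j, ?_⟩⟩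
    · by_cases hm : m = i
      · rw [hm, hvi, mul_zero, mul_zero]
      · refine mul_le_mul_of_nonneg_right
          (Real.log_le_log (by linarith [hratio i m]) ?_) (hv m)
        have := mul_le_mul_of_nonneg_left hlt.le (hGnn m k)
        rw [← hcol m hm, mul_one_div] at this
        linarith [mul_le_mul_of_nonneg_left this hε.le]
    · refine mul_lt_mul_of_pos_right (Real.log_lt_log (by linarith [hratio i j]) ?_) hvj
      have := mul_lt_mul_of_pos_left hlt hGk
      rw [← hcol j hji, mul_one_div] at this
      linarith [mul_lt_mul_of_pos_left this hε]
end

section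
/- Under Assumptions (A) and (B), suppose the routing matrix P has a branching structure and let ρ ∈ ℝ^d satisfy (ρP)_i < ρ_i for all i. Then for every ε with 0 < ε < min_{1≤i≤d} (ρ_i/G_{ii})(μ_i/ν_i − 1), the function h_{ε,ρ}(x) = Σ_{i=1}^d Π_{j=1}^d (1 + ε G_{ji}/ρ_i)^{x^j} satisfies limsup_{|x|→∞, x∈ℤ_+^d} (ℒh_{ε,ρ})(x)/h_{ε,ρ}(x) = − ε · min_{1≤i≤d} (μ_i/(ρ_i + ε G_{ii}) − ν_i/ρ_i) < 0. -/
open scoped BigOperators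
open Filter

/-- The exponential function `x ↦ ∏ j, a j ^ x j` on `ℤ_+^d`. -/
def expFun {d : ℕ} (a : Fin d → ℝ) (x : Fin d → ℕ) : ℝ := ∏ j, a j ^ x j

lemma expFun_add_single {d : ℕ} (a : Fin d → ℝ) (x : Fin d → ℕ) (k : Fin d) :
    expFun a (x + Pi.single k 1) = expFun a x * a k := by
  simp only [expFun, Pi.add_apply, pow_add, Finset.prod_mul_distrib]
  congr 1
  rw [Finset.prod_eq_single k]
  · simp
  · intro j _ hj
    simp [hj]
  · simp

lemma expFun_single {d : ℕ} (a : Fin d → ℝ) (k : Fin d) (n : ℕ) :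
    expFun a (Pi.single k n) = a k ^ n := by
  rw [expFun, Finset.prod_eq_single k]
  · simp
  · intro j _ hj
    simp [hj]
  · simp

lemma hasSum_displacement {d : ℕ} (x z₀ : Fin d → ℕ) (y : Fin d → ℤ)
    (h : ∀ k, (z₀ k : ℤ) - x k = y k) (g : (Fin d → ℕ) → ℝ) :
    HasSum (fun z : Fin d → ℕ =>
      (if (fun k => (z k : ℤ) - (x k : ℤ)) = y then (1 : ℝ) else 0) * g z) (g z₀) := by
  have h₀ : (fun k => (z₀ k : ℤ) - (x k : ℤ)) = y := funext h
  convert hasSum_single z₀ _ using 1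
  · simp [h₀]
  · intro z hz
    rw [if_neg, zero_mul]
    intro hy
    apply hz
    funext k
    have h₁ := congrFun (hy.trans h₀.symm) k
    omega

lemma hasSum_displacement_of_neg {d : ℕ} (x : Fin d → ℕ) (y : Fin d → ℤ) (k : Fin d)
    (h : (x k : ℤ) + y k < 0) (g : (Fin d → ℕ) → ℝ) :
    HasSum (fun z : Fin d → ℕ =>
      (if (fun k => (z k : ℤ) - (x k : ℤ)) = y then (1 : ℝ) else 0) * g z) 0 := by
  convert hasSum_zero using 1
  funext z
  rw [if_neg, zero_mul]
  intro hy
  have := congrFun hy k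
  omega

lemma hasSum_arrival {d : ℕ} (a : Fin d → ℝ) (x : Fin d → ℕ) (k : Fin d) :
    HasSum (fun z : Fin d → ℕ =>
      (if (fun k => (z k : ℤ) - (x k : ℤ)) = unitZ k then (1 : ℝ) else 0)
        * (expFun a z - expFun a x)) (expFun a x * (a k - 1)) := by
  convert hasSum_displacement x (x + Pi.single k 1) (unitZ k) _
    (fun z => expFun a z - expFun a x) using 1
  · rw [expFun_add_single]
    ring
  · intro l
    by_cases hl : l = k
    · subst hl
      simp [unitZ]
    · simp [unitZ, hl]

lemma exists_eq_add_single {d : ℕ} (x : Fin d → ℕ) (k : Fin d) (hx : x k ≠ 0) :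
    ∃ x' : Fin d → ℕ, x = x' + Pi.single k 1 := by
  refine ⟨x - Pi.single k 1, ?_⟩
  funext l
  by_cases hl : l = k
  · subst hl
    simp only [Pi.add_apply, Pi.sub_apply, Pi.single_eq_same]
    omega
  · simp [hl]

lemma hasSum_departure {d : ℕ} (a : Fin d → ℝ) (ha : ∀ j, 0 < a j) (x : Fin d → ℕ)
    (k : Fin d) :
    HasSum (fun z : Fin d → ℕ =>
      (if (fun k => (z k : ℤ) - (x k : ℤ)) = -unitZ k then (1 : ℝ) else 0)
        * (expFun a z - expFun a x))
      (expFun a x * if x k = 0 then 0 else 1 / a k - 1) := by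
  by_cases hx : x k = 0
  · rw [if_pos hx, mul_zero]
    exact hasSum_displacement_of_neg x _ k (by simp [unitZ, hx]) _
  · rw [if_neg hx]
    obtain ⟨x', rfl⟩ := exists_eq_add_single x k hx
    convert hasSum_displacement (x' + Pi.single k 1) x' (-unitZ k) _
      (fun z => expFun a z - expFun a (x' + Pi.single k 1)) using 1
    · rw [expFun_add_single]
      have := (ha k).ne'
      field_simp
    · intro l
      by_cases hl : l = k
      · subst hl
        simp [unitZ]
      · simp [unitZ, hl]

lemma hasSum_transfer {d : ℕ} (a : Fin d → ℝ) (ha : ∀ j, 0 < a j) (x : Fin d → ℕ)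
    (k j : Fin d) (hkj : k ≠ j) :
    HasSum (fun z : Fin d → ℕ =>
      (if (fun k => (z k : ℤ) - (x k : ℤ)) = unitZ j - unitZ k then (1 : ℝ) else 0)
        * (expFun a z - expFun a x))
      (expFun a x * if x k = 0 then 0 else a j / a k - 1) := by
  by_cases hx : x k = 0
  · rw [if_pos hx, mul_zero]
    exact hasSum_displacement_of_neg x _ k (by simp [unitZ, hx, hkj]) _
  · rw [if_neg hx]
    obtain ⟨x', rfl⟩ := exists_eq_add_single x k hx
    convert hasSum_displacement (x' + Pi.single k 1) (x' + Pi.single j 1) (unitZ j - unitZ k) _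
      (fun z => expFun a z - expFun a (x' + Pi.single k 1)) using 1
    · rw [expFun_add_single, expFun_add_single]
      have := (ha k).ne'
      field_simp
    · intro l
      by_cases hl : l = k
      · subst hl
        simp [unitZ, hkj]
      · by_cases hl' : l = j
        · subst hl'
          simp [unitZ, hl]
        · simp [unitZ, hl, hl']

/-- The action of the generator on `expFun a`. -/
lemma hasSum_gen_expFun {d : ℕ} (lam mu : Fin d → ℝ) (P : Fin d → Fin d → ℝ)
    (hPdiag : ∀ i, P i i = 0) (a : Fin d → ℝ) (ha : ∀ j, 0 < a j) (x : Fin d → ℕ) :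
    HasSum (fun z : Fin d → ℕ => qrate lam mu P (fun k => (z k : ℤ) - (x k : ℤ))
        * (expFun a z - expFun a x))
      (expFun a x * (∑ k, lam k * (a k - 1)
        + ∑ k, if x k = 0 then 0 else
            mu k / a k * (1 - a k + ∑ j, P k j * (a j - 1)))) := by
  have h₁ := hasSum_sum (s := Finset.univ)
    (fun k (_ : k ∈ Finset.univ) => (hasSum_arrival a x k).mul_left (lam k))
  have h₂ := hasSum_sum (s := Finset.univ)
    (fun k (_ : k ∈ Finset.univ) =>
      (hasSum_departure a ha x k).mul_left (mu k * (1 - ∑ j, P k j)))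
  have h₃ : HasSum (fun z : Fin d → ℕ => ∑ k, ∑ j, mu k * P k j *
      ((if (fun k => (z k : ℤ) - (x k : ℤ)) = unitZ j - unitZ k then (1 : ℝ) else 0)
        * (expFun a z - expFun a x)))
      (∑ k, ∑ j, mu k * P k j *
        (expFun a x * if x k = 0 then 0 else a j / a k - 1)) := by
    refine hasSum_sum fun k _ => hasSum_sum fun j _ => ?_
    by_cases hkj : k = j
    · subst hkj
      simp [hPdiag, hasSum_zero]
    · exact (hasSum_transfer a ha x k j hkj).mul_left _
  convert (h₁.add h₂).add h₃ using 1
  · rfl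
  · funext z
    simp only [qrate, add_mul, Finset.sum_mul, mul_assoc]
  · rw [mul_add, Finset.mul_sum, Finset.mul_sum, add_assoc,
      ← Finset.sum_add_distrib (f := fun k => mu k * (1 - ∑ j, P k j) * _)]
    congr 1
    · exact Finset.sum_congr rfl fun k _ => by ring
    · refine Finset.sum_congr rfl fun k _ => ?_
      by_cases hx : x k = 0
      · simp [hx]
      · have hk := (ha k).ne'
        simp only [hx, if_false]
        have e₁ : ∑ j, mu k * P k j * (expFun a x * (a j / a k - 1))
            = mu k / a k * expFun a x * ∑ j, P k j * (a j - 1)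
              + mu k * expFun a x * (1 / a k - 1) * ∑ j, P k j := by
          rw [Finset.mul_sum, Finset.mul_sum, ← Finset.sum_add_distrib]
          refine Finset.sum_congr rfl fun j _ => ?_
          field_simp
          ring
        rw [e₁]
        field_simp
        ring

lemma one_le_expFun {d : ℕ} (a : Fin d → ℝ) (ha : ∀ j, 1 ≤ a j) (x : Fin d → ℕ) :
    1 ≤ expFun a x := by
  unfold expFun
  exact Finset.prod_induction _ (fun t : ℝ => 1 ≤ t)
    (fun s t hs ht => one_le_mul_of_one_le_of_one_le hs ht) le_rfl
    (fun j _ => one_le_pow₀ (ha j))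

lemma pow_le_expFun {d : ℕ} (a : Fin d → ℝ) (ha : ∀ j, 1 ≤ a j) (x : Fin d → ℕ)
    (k : Fin d) : a k ^ x k ≤ expFun a x := by
  unfold expFun
  rw [← Finset.mul_prod_erase Finset.univ _ (Finset.mem_univ k)]
  refine le_mul_of_one_le_right (pow_nonneg (zero_le_one.trans (ha k)) _) ?_
  exact Finset.prod_induction _ (fun t : ℝ => 1 ≤ t)
    (fun s t hs ht => one_le_mul_of_one_le_of_one_le hs ht) le_rfl
    (fun j _ => one_le_pow₀ (ha j))

/-- A sum of exponential functions whose diagonal bases exceed `1` tends to infinity. -/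
lemma tendsto_sum_expFun {d : ℕ} (a : Fin d → Fin d → ℝ) (ha : ∀ i j, 1 ≤ a i j)
    (hdiag : ∀ i, 1 < a i i) :
    Tendsto (fun x => ∑ i, expFun (a i) x) cofinite atTop := by
  rw [tendsto_atTop]
  intro M
  rw [eventually_cofinite]
  have hN : ∀ i, ∃ n : ℕ, M < a i i ^ n := fun i => pow_unbounded_of_one_lt M (hdiag i)
  choose N hN using hN
  refine (Set.finite_Iic N).subset ?_
  intro x hx i
  by_contra! hlt
  refine hx ?_
  calc M ≤ a i i ^ N i := (hN i).le
    _ ≤ a i i ^ x i := pow_le_pow_right₀ (ha i i) hlt.le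
    _ ≤ expFun (a i) x := pow_le_expFun _ (ha i) x i
    _ ≤ ∑ l, expFun (a l) x :=
      Finset.single_le_sum (f := fun l => expFun (a l) x)
        (fun l _ => zero_le_one.trans (one_le_expFun _ (ha l) x)) (Finset.mem_univ i)

/-- If on the face `x i = 0` the base `a i` is dominated by `a p`, strictly in every coordinate
where it is not `1`, then `expFun (a i)` is negligible on that face. -/
lemma eventually_expFun_le {d : ℕ} (a : Fin d → Fin d → ℝ) (ha : ∀ i j, 1 ≤ a i j)
    (hdiag : ∀ i, 1 < a i i) (i p : Fin d)
    (hp : ∀ j, j ≠ i → a i j = 1 ∨ a i j < a p j) (η : ℝ) (hη : 0 < η) :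
    ∀ᶠ x in cofinite, x i = 0 → expFun (a i) x ≤ η * ∑ l, expFun (a l) x := by
  classical
  set S : Finset (Fin d) := Finset.univ.filter fun j => j ≠ i ∧ a i j < a p j with hS
  obtain ⟨r, hr, hr0, hr1⟩ : ∃ r : ℝ, (∀ j ∈ S, a i j < r * a p j) ∧ 0 < r ∧ r < 1 := by
    have h₁ : ∀ᶠ r : ℝ in nhdsWithin 1 (Set.Iio 1), ∀ j ∈ S, a i j < r * a p j := by
      rw [Filter.eventually_all_finset]
      intro j hj
      have hlt : a i j < 1 * a p j := by
        rw [one_mul]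
        exact (Finset.mem_filter.mp hj).2.2
      have hc : Tendsto (fun r : ℝ => r * a p j) (nhds 1) (nhds (1 * a p j)) :=
        (continuous_id.mul continuous_const).tendsto 1
      exact (hc.eventually (lt_mem_nhds hlt)).filter_mono nhdsWithin_le_nhds
    have h₂ : ∀ᶠ r : ℝ in nhdsWithin 1 (Set.Iio 1), 0 < r :=
      (lt_mem_nhds one_pos).filter_mono nhdsWithin_le_nhds
    have h₃ : ∀ᶠ r : ℝ in nhdsWithin 1 (Set.Iio 1), r < 1 := self_mem_nhdsWithin
    exact (h₁.and (h₂.and h₃)).exists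
  set A : ℝ := ∑ j, a i j with hA
  have hnn : ∀ i j, 0 ≤ a i j := fun i j => zero_le_one.trans (ha i j)
  have hleA : ∀ j, a i j ≤ A := fun j =>
    Finset.single_le_sum (fun l _ => hnn i l) (Finset.mem_univ j)
  have hA1 : 1 ≤ A := (ha i i).trans (hleA i)
  have hone : ∀ j, j ∉ S → j ≠ i → a i j = 1 := by
    intro j hj hji
    refine (hp j hji).resolve_right fun h => hj ?_
    simp [hS, hji, h]
  have hprod : ∀ (t : ℝ) (x : Fin d → ℕ),
      ∏ j, (if j ∈ S then t ^ x j else 1) = t ^ ∑ j ∈ S, x j := by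
    intro t x
    rw [Finset.prod_ite_mem, Finset.univ_inter, Finset.prod_pow_eq_pow_sum]
  have hup : ∀ x : Fin d → ℕ, x i = 0 → expFun (a i) x ≤ A ^ ∑ j ∈ S, x j := by
    intro x hx
    rw [← hprod]
    refine Finset.prod_le_prod (fun j _ => pow_nonneg (hnn i j) _) fun j _ => ?_
    by_cases hj : j ∈ S
    · rw [if_pos hj]
      exact pow_le_pow_left₀ (hnn i j) (hleA j) _
    · rw [if_neg hj]
      by_cases hji : j = i
      · simp [hji, hx]
      · simp [hone j hj hji]
  have hdom : ∀ x : Fin d → ℕ, x i = 0 →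
      expFun (a i) x ≤ r ^ (∑ j ∈ S, x j) * expFun (a p) x := by
    intro x hx
    rw [← hprod, expFun, expFun, ← Finset.prod_mul_distrib]
    refine Finset.prod_le_prod (fun j _ => pow_nonneg (hnn i j) _) fun j _ => ?_
    by_cases hj : j ∈ S
    · rw [if_pos hj, ← mul_pow]
      exact pow_le_pow_left₀ (hnn i j) (hr j hj).le _
    · rw [if_neg hj, one_mul]
      by_cases hji : j = i
      · simp [hji, hx]
      · rw [hone j hj hji, one_pow]
        exact one_le_pow₀ (ha p j)
  obtain ⟨K, hK⟩ := exists_pow_lt_of_lt_one hη hr1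
  filter_upwards [(tendsto_sum_expFun a ha hdiag).eventually_ge_atTop (A ^ K / η)] with x hx hxi
  have hple : expFun (a p) x ≤ ∑ l, expFun (a l) x :=
    Finset.single_le_sum (f := fun l => expFun (a l) x)
      (fun l _ => zero_le_one.trans (one_le_expFun _ (ha l) x)) (Finset.mem_univ p)
  have hp0 : 0 ≤ expFun (a p) x := zero_le_one.trans (one_le_expFun _ (ha p) x)
  rcases le_total K (∑ j ∈ S, x j) with h | h
  · calc expFun (a i) x ≤ r ^ (∑ j ∈ S, x j) * expFun (a p) x := hdom x hxi
      _ ≤ η * ∑ l, expFun (a l) x :=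
        mul_le_mul ((pow_le_pow_of_le_one hr0.le hr1.le h).trans hK.le) hple hp0 hη.le
  · calc expFun (a i) x ≤ A ^ (∑ j ∈ S, x j) := hup x hxi
      _ ≤ A ^ K := pow_le_pow_right₀ hA1 h
      _ ≤ η * ∑ l, expFun (a l) x := by
        rw [div_le_iff₀ hη] at hx
        linarith

/-- Abstract form of the asymptotics: the weighted average of `b i - e i * 1{x i > 0}`. -/
lemma limsup_weighted_average {d : ℕ} (hd : 0 < d) (w : Fin d → (Fin d → ℕ) → ℝ)
    (hw : ∀ i x, 0 < w i x) (b e : Fin d → ℝ) (he : ∀ i, 0 ≤ e i) (hbe : ∀ i, b i < e i)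
    (hface : ∀ i, ∀ η > 0, ∀ᶠ x in cofinite, x i = 0 → w i x ≤ η * ∑ l, w l x)
    (haxis : ∀ i l, l ≠ i → ∀ η > 0,
      ∀ᶠ n : ℕ in atTop, w l (Pi.single i n) ≤ η * w i (Pi.single i n)) :
    limsup (fun x => (∑ i, w i x * (b i - if x i = 0 then 0 else e i)) / ∑ i, w i x) cofinite
      = -⨅ i, (e i - b i) := by
  have : Nonempty (Fin d) := ⟨⟨0, hd⟩⟩
  set F : (Fin d → ℕ) → ℝ :=
    fun x => (∑ i, w i x * (b i - if x i = 0 then 0 else e i)) / ∑ i, w i x with hF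
  set m : ℝ := ⨅ i, (e i - b i) with hm
  have hmle : ∀ i, m ≤ e i - b i := fun i => ciInf_le (Set.finite_range _).bddBelow i
  have hsum : ∀ x, 0 < ∑ i, w i x := fun x =>
    Finset.sum_pos (fun i _ => hw i x) Finset.univ_nonempty
  have hupper : ∀ η > 0, ∀ᶠ x in cofinite, F x ≤ -m + η := by
    intro η hη
    have hE : 0 < ∑ i, e i + 1 := by
      have := Finset.sum_nonneg fun i (_ : i ∈ Finset.univ) => he i
      linarith
    filter_upwards [eventually_all.mpr fun i => hface i (η / (∑ i, e i + 1)) (div_pos hη hE)]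
      with x hx
    rw [hF]
    simp only
    rw [div_le_iff₀ (hsum x)]
    calc ∑ i, w i x * (b i - if x i = 0 then 0 else e i)
        ≤ ∑ i, (-m * w i x + e i * (η / (∑ i, e i + 1) * ∑ l, w l x)) := by
          refine Finset.sum_le_sum fun i _ => ?_
          have h₁ := mul_le_mul_of_nonneg_left (hmle i) (hw i x).le
          by_cases hxi : x i = 0
          · rw [if_pos hxi]
            have h₂ := mul_le_mul_of_nonneg_left (hx i hxi) (he i)
            linarith
          · rw [if_neg hxi]
            have h₂ : 0 ≤ e i * (η / (∑ i, e i + 1) * ∑ l, w l x) :=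
              mul_nonneg (he i) (mul_nonneg (div_pos hη hE).le (hsum x).le)
            linarith
      _ = -m * ∑ l, w l x + (∑ i, e i) / (∑ i, e i + 1) * (η * ∑ l, w l x) := by
          rw [Finset.sum_add_distrib, ← Finset.mul_sum, ← Finset.sum_mul]
          ring
      _ ≤ -m * ∑ l, w l x + 1 * (η * ∑ l, w l x) := by
          have h₁ : (∑ i, e i) / (∑ i, e i + 1) ≤ 1 := by
            rw [div_le_one hE]
            linarith
          have h₂ := mul_le_mul_of_nonneg_right h₁ (mul_pos hη (hsum x)).le
          linarith
      _ = (-m + η) * ∑ l, w l x := by ring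
  have hlower : ∀ η > 0, ∃ᶠ x in cofinite, -m - η ≤ F x := by
    intro η hη
    obtain ⟨i, hi⟩ := exists_eq_ciInf_of_finite (f := fun i => e i - b i)
    have hC : 0 < ∑ l, (e l - b l) :=
      Finset.sum_pos (fun l _ => sub_pos.mpr (hbe l)) Finset.univ_nonempty
    have hinj : Function.Injective fun n : ℕ => (Pi.single i n : Fin d → ℕ) :=
      Pi.single_injective (M := fun _ : Fin d => ℕ) i
    have htend : Tendsto (fun n : ℕ => (Pi.single i n : Fin d → ℕ)) atTop cofinite := by
      rw [← Nat.cofinite_eq_atTop]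
      exact hinj.tendsto_cofinite
    refine htend.frequently (Eventually.frequently ?_)
    have hall : ∀ᶠ n : ℕ in atTop, ∀ l, l ≠ i →
        w l (Pi.single i n) ≤ η / (∑ l, (e l - b l)) * w i (Pi.single i n) := by
      rw [eventually_all]
      intro l
      by_cases hl : l = i
      · exact Eventually.of_forall fun n h => absurd hl h
      · filter_upwards [haxis i l hl _ (div_pos hη hC)] with n hn _
        exact hn
    filter_upwards [hall] with n hn
    set x : Fin d → ℕ := Pi.single i n with hx
    rw [hF]
    simp only
    rw [le_div_iff₀ (hsum x)]
    have hwi : w i x ≤ ∑ l, w l x :=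
      Finset.single_le_sum (f := fun l => w l x) (fun l _ => (hw l x).le) (Finset.mem_univ i)
    have hq : 0 < η / ∑ l, (e l - b l) := div_pos hη hC
    calc (-m - η) * ∑ l, w l x
        = -(m * ∑ l, w l x)
            - (∑ l, (e l - b l)) * (η / (∑ l, (e l - b l)) * ∑ l, w l x) := by
          field_simp
      _ = ∑ l, (-(m * w l x) - (e l - b l) * (η / (∑ l, (e l - b l)) * ∑ l, w l x)) := by
          generalize η / (∑ l, (e l - b l)) * ∑ l, w l x = q
          rw [Finset.sum_sub_distrib (f := fun l => -(m * w l x)), Finset.sum_neg_distrib,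
            ← Finset.mul_sum, ← Finset.sum_mul]
      _ ≤ ∑ l, w l x * (b l - if x l = 0 then 0 else e l) := by
          refine Finset.sum_le_sum fun l _ => ?_
          have hcl : 0 < e l - b l := sub_pos.mpr (hbe l)
          have h₁ : -((e l - b l) * w l x) ≤ w l x * (b l - if x l = 0 then 0 else e l) := by
            have h₃ := mul_nonneg (he l) (hw l x).le
            split_ifs <;> linarith
          refine le_trans ?_ h₁
          have hm0 : 0 < m := by
            have := sub_pos.mpr (hbe i)
            rw [hm, ← hi]
            exact this
          by_cases hl : l = i
          · subst hl
            have h₂ : m = e l - b l := hi.symm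
            have h₃ : 0 ≤ (e l - b l) * (η / (∑ l, (e l - b l)) * ∑ l, w l x) :=
              mul_nonneg hcl.le (mul_pos hq (hsum x)).le
            rw [← h₂] at h₃ ⊢
            linarith
          · have h₂ := (hn l hl).trans (mul_le_mul_of_nonneg_left hwi hq.le)
            have h₃ := mul_le_mul_of_nonneg_left h₂ hcl.le
            have h₄ := mul_pos hm0 (hw l x)
            linarith
  have hcob : IsCoboundedUnder (· ≤ ·) cofinite F :=
    IsCobounded.of_frequently_ge (hlower 1 one_pos)
  have hbdd : IsBoundedUnder (· ≤ ·) cofinite F := ⟨-m + 1, hupper 1 one_pos⟩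
  refine le_antisymm ?_ ?_
  · exact le_of_forall_pos_le_add fun η hη => limsup_le_of_le hcob (hupper η hη)
  · refine le_of_forall_pos_le_add fun η hη => ?_
    have := le_limsup_of_frequently_le (hlower η hη) hbdd
    linarith

/-- Corollary 3.1: if the routing matrix has a branching structure and ρ satisfies
(ρP)_i < ρ_i for all i, then for every ε with 0 < ε < min_i (ρ_i/G_ii)(μ_i/ν_i - 1)
the function h_{ε,ρ}(x) = Σ_i Π_j (1 + ε G_ji/ρ_i)^{x_j} satisfies
limsup (ℒ h)(x)/h(x) = -ε min_i (μ_i/(ρ_i + ε G_ii) - ν_i/ρ_i) < 0. -/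
theorem stmt8
    (d : ℕ) (hd : 0 < d)
    (lam mu : Fin d → ℝ) (P : Fin d → Fin d → ℝ)
    (hlam : ∀ i, 0 ≤ lam i) (hmu : ∀ i, 0 < mu i)
    (hP : ∀ i j, 0 ≤ P i j) (hPdiag : ∀ i, P i i = 0) (hP0 : ∀ i, ∑ j, P i j ≤ 1)
    (hA : AssumptionA lam mu P)
    (G : Fin d → Fin d → ℝ)
    (hG1 : ∀ i k, ∑ j, G i j * ((if j = k then (1 : ℝ) else 0) - P j k)
      = if i = k then 1 else 0)
    (hG2 : ∀ i k, ∑ j, ((if i = j then (1 : ℝ) else 0) - P i j) * G j k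
      = if i = k then 1 else 0)
    (hGnn : ∀ i j, 0 ≤ G i j) (hGdiag : ∀ i, 1 ≤ G i i)
    (ν : Fin d → ℝ) (hν : ∀ j, ν j = lam j + ∑ i, ν i * P i j) (hνpos : ∀ i, 0 < ν i)
    (hB : ∀ i, ν i < mu i)
    (hB : Branching P)
    (ρ : Fin d → ℝ) (hρ : ∀ i, ∑ j, ρ j * P j i < ρ i)
    (ε : ℝ) (hε : 0 < ε)
    (hεlt : ∀ i : Fin d, ε < ρ i / G i i * (mu i / ν i - 1)) :
    Filter.limsup
        (fun x : Fin d → ℕ =>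
          gen lam mu P (fun y => ∑ i, ∏ j, (1 + ε * G j i / ρ i) ^ (y j)) x
            / ∑ i, ∏ j, (1 + ε * G j i / ρ i) ^ (x j))
        Filter.cofinite
      = -(ε * ⨅ i : Fin d, (mu i / (ρ i + ε * G i i) - ν i / ρ i))
    ∧ 0 < ε * ⨅ i : Fin d, (mu i / (ρ i + ε * G i i) - ν i / ρ i) := by
  have hGrec : ∀ j i, G j i = (if j = i then 1 else 0) + ∑ k, G j k * P k i := by
    intro j i
    have h := hG1 j i
    simp only [mul_sub, Finset.sum_sub_distrib, mul_ite, mul_one, mul_zero,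
      Finset.sum_ite_eq', Finset.mem_univ, if_true] at h
    linarith
  have hPG : ∀ k i, ∑ j, P k j * G j i = G k i - if k = i then 1 else 0 := by
    intro k i
    have h := hG2 k i
    simp only [sub_mul, Finset.sum_sub_distrib, ite_mul, one_mul, zero_mul,
      Finset.sum_ite_eq, Finset.mem_univ, if_true] at h
    linarith
  have hlamG : ∀ i, ∑ k, lam k * G k i = ν i := by
    intro i
    have h₁ : ∀ k, lam k = ν k - ∑ j, ν j * P j k := fun k => by linarith [hν k]
    have h₂ : ∑ k, (∑ j, ν j * P j k) * G k i = ∑ j, ν j * ∑ k, P j k * G k i := by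
      simp only [Finset.sum_mul, Finset.mul_sum]
      rw [Finset.sum_comm]
      simp only [mul_assoc]
    simp only [h₁, sub_mul, Finset.sum_sub_distrib, h₂, hPG, mul_sub]
    simp
  have hρpos : ∀ i, 0 < ρ i := by
    intro i
    have h₂ : ∑ k, (∑ j, ρ j * P j k) * G k i = ∑ j, ρ j * ∑ k, P j k * G k i := by
      simp only [Finset.sum_mul, Finset.mul_sum]
      rw [Finset.sum_comm]
      simp only [mul_assoc]
    have h₃ : ρ i = ∑ k, (ρ k - ∑ j, ρ j * P j k) * G k i := by
      simp only [sub_mul, Finset.sum_sub_distrib, h₂, hPG, mul_sub]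
      simp
    rw [h₃]
    refine Finset.sum_pos' (fun k _ => mul_nonneg (sub_pos.mpr (hρ k)).le (hGnn k i))
      ⟨i, Finset.mem_univ i, mul_pos (sub_pos.mpr (hρ i)) (one_pos.trans_le (hGdiag i))⟩
  have hGd : ∀ i, 0 < G i i := fun i => one_pos.trans_le (hGdiag i)
  set a : Fin d → Fin d → ℝ := fun i j => 1 + ε * G j i / ρ i with ha_def
  have ha1 : ∀ i j, 1 ≤ a i j := fun i j =>
    le_add_of_nonneg_right (div_nonneg (mul_nonneg hε.le (hGnn j i)) (hρpos i).le)
  have ha0 : ∀ i j, 0 < a i j := fun i j => one_pos.trans_le (ha1 i j)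
  have hadiag : ∀ i, 1 < a i i := fun i =>
    lt_add_of_pos_right _ (div_pos (mul_pos hε (hGd i)) (hρpos i))
  have halt : ∀ i l j k, G j i / ρ i < G k l / ρ l → a i j < a l k := by
    intro i l j k h
    have := mul_lt_mul_of_pos_left h hε
    simp only [ha_def, mul_div_assoc]
    linarith
  set b : Fin d → ℝ := fun i => ε * (ν i / ρ i) with hb_def
  set e : Fin d → ℝ := fun i => ε * (mu i / (ρ i + ε * G i i)) with he_def
  have hden : ∀ i, 0 < ρ i + ε * G i i := fun i => add_pos (hρpos i) (mul_pos hε (hGd i))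
  have hcpos : ∀ i, 0 < mu i / (ρ i + ε * G i i) - ν i / ρ i := by
    intro i
    have h := hεlt i
    have h₁ : ρ i / G i i * (mu i / ν i - 1) = ρ i * (mu i - ν i) / (G i i * ν i) := by
      have := (hGd i).ne'
      have := (hνpos i).ne'
      field_simp
    rw [h₁, lt_div_iff₀ (mul_pos (hGd i) (hνpos i))] at h
    rw [sub_pos, div_lt_div_iff₀ (hρpos i) (hden i)]
    linarith
  have hbe : ∀ i, b i < e i := fun i =>
    mul_lt_mul_of_pos_left (sub_pos.mp (hcpos i)) hε
  have hgen : ∀ x, gen lam mu P (fun y => ∑ i, expFun (a i) y) x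
      = ∑ i, expFun (a i) x * (b i - if x i = 0 then 0 else e i) := by
    intro x
    have h := hasSum_sum (s := Finset.univ) fun i (_ : i ∈ Finset.univ) =>
      hasSum_gen_expFun lam mu P hPdiag (a i) (ha0 i) x
    simp only [← Finset.mul_sum, Finset.sum_sub_distrib] at h
    refine h.tsum_eq.trans ?_
    refine Finset.sum_congr rfl fun i _ => ?_
    have hρi := (hρpos i).ne'
    congr 1
    have e₁ : ∑ k, lam k * (a i k - 1) = b i := by
      have : ∀ k, lam k * (a i k - 1) = ε / ρ i * (lam k * G k i) := fun k => by
        simp only [ha_def]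
        ring
      simp only [this, ← Finset.mul_sum, hlamG, hb_def]
      ring
    have e₂ : ∀ k, 1 - a i k + ∑ j, P k j * (a i j - 1)
        = -(ε / ρ i * if k = i then 1 else 0) := by
      intro k
      have : ∀ j, P k j * (a i j - 1) = ε / ρ i * (P k j * G j i) := fun j => by
        simp only [ha_def]
        ring
      simp only [this, ← Finset.mul_sum, hPG]
      simp only [ha_def]
      ring
    rw [e₁, sub_eq_add_neg]
    congr 1
    simp only [e₂]
    rw [Finset.sum_eq_single i]
    · by_cases hx : x i = 0
      · simp [hx]
      · have := (hden i).ne'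
        have h2 : 1 + ε * G i i / ρ i = (ρ i + ε * G i i) / ρ i := by field_simp
        simp only [hx, if_false, if_true, he_def, ha_def, h2]
        field_simp
    · intro k _ hk
      simp [hk]
    · simp
  have hface : ∀ i, ∀ η > 0, ∀ᶠ x : Fin d → ℕ in cofinite,
      x i = 0 → expFun (a i) x ≤ η * ∑ l, expFun (a l) x := by
    intro i
    by_cases hpar : ∃ p, 0 < P p i
    · obtain ⟨p, hp⟩ := hpar
      refine eventually_expFun_le a ha1 hadiag i p fun j hj => ?_
      have hz : ∀ k, k ≠ p → P k i = 0 := fun k hk =>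
        le_antisymm (not_lt.mp fun h => hk (hB i k p h hp)) (hP k i)
      have hs : ∀ c : Fin d → ℝ, ∑ k, c k * P k i = c p * P p i := fun c =>
        Finset.sum_eq_single p (fun k _ hk => by rw [hz k hk, mul_zero]) (by simp)
      have hG := hGrec j i
      rw [if_neg hj, zero_add, hs] at hG
      have hρp := hρ i
      rw [hs] at hρp
      rcases (hGnn j p).eq_or_lt with h0 | h0
      · left
        simp [ha_def, hG, ← h0]
      · right
        refine halt _ _ _ _ ?_
        rw [hG, div_lt_div_iff₀ (hρpos i) (hρpos p)]
        have := mul_lt_mul_of_pos_left hρp h0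
        linarith
    · refine eventually_expFun_le a ha1 hadiag i i fun j hj => Or.inl ?_
      have hz : ∀ k, P k i = 0 := fun k =>
        le_antisymm (not_lt.mp fun h => hpar ⟨k, h⟩) (hP k i)
      have hG := hGrec j i
      simp only [if_neg hj, hz, mul_zero, Finset.sum_const_zero, add_zero] at hG
      simp [ha_def, hG]
  have hmax : ∀ i l, l ≠ i → a l i < a i i := by
    intro i
    have : Nonempty (Fin d) := ⟨i⟩
    obtain ⟨t, ht⟩ := Finite.exists_max fun l => G i l / ρ l
    have hMpos : 0 < G i t / ρ t := (div_pos (hGd i) (hρpos i)).trans_le (ht i)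
    have hlt : ∀ l, l ≠ i → G i l / ρ l < G i t / ρ t := by
      intro l hl
      rw [div_lt_iff₀ (hρpos l), hGrec i l, if_neg hl.symm, zero_add]
      calc ∑ k, G i k * P k l ≤ ∑ k, G i t / ρ t * (ρ k * P k l) := by
            refine Finset.sum_le_sum fun k _ => ?_
            have := (div_le_iff₀ (hρpos k)).mp (ht k)
            rw [← mul_assoc]
            exact mul_le_mul_of_nonneg_right this (hP k l)
        _ = G i t / ρ t * ∑ k, ρ k * P k l := by rw [Finset.mul_sum]
        _ < G i t / ρ t * ρ l := mul_lt_mul_of_pos_left (hρ l) hMpos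
    have hti : t = i := by
      by_contra h
      exact lt_irrefl _ (hlt t h)
    intro l hl
    have := hlt l hl
    rw [hti] at this
    exact halt _ _ _ _ this
  have haxis : ∀ i l, l ≠ i → ∀ η > 0, ∀ᶠ n : ℕ in atTop,
      expFun (a l) (Pi.single i n) ≤ η * expFun (a i) (Pi.single i n) := by
    intro i l hl η hη
    simp only [expFun_single]
    have hlim := tendsto_pow_atTop_nhds_zero_of_lt_one
      (div_pos (ha0 l i) (ha0 i i)).le ((div_lt_one (ha0 i i)).mpr (hmax i l hl))
    filter_upwards [hlim.eventually (gt_mem_nhds hη)] with n hn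
    rw [div_pow, div_lt_iff₀ (pow_pos (ha0 i i) n)] at hn
    exact hn.le
  have hinf : ε * ⨅ i, (mu i / (ρ i + ε * G i i) - ν i / ρ i) = ⨅ i, (e i - b i) := by
    rw [Real.mul_iInf_of_nonneg hε.le]
    simp only [he_def, hb_def, mul_sub]
  refine ⟨?_, ?_⟩
  · rw [hinf, ← limsup_weighted_average hd (fun i => expFun (a i))
      (fun i x => one_pos.trans_le (one_le_expFun _ (ha1 i) x)) b e
      (fun i => (mul_pos hε (div_pos (hmu i) (hden i))).le) hbe hface haxis]
    simp only [← hgen]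
    rfl
  · have : Nonempty (Fin d) := ⟨⟨0, hd⟩⟩
    obtain ⟨i, hi⟩ :=
      exists_eq_ciInf_of_finite (f := fun i => mu i / (ρ i + ε * G i i) - ν i / ρ i)
    rw [← hi]
    exact mul_pos hε (hcpos i)
end
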